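/- arXiv:math/9811141 — 5 statements merged into one kernel-verified Lean document; each statement's English description precedes it below -/
import Mathlib

section
/- (Proposition 2, relations (28c) and (28d).) For all 2 ≤ i ≤ N and 1 ≤ j ≤ N: e_i·a_j^+ − (−1)^{p_iθ_j}·a_j^+·e_i = δ_{ij}·a_{i−1}^+·κ_i, where κ_i = k̄_i if θ_{i−1} = 0 and κ_i = k_i if θ_{i−1} = 1; and f_i·a_j^- − (−1)^{p_iθ_j}·a_j^-·f_i = −(−1)^{p_i}·δ_{ij}·λ_i·a_{i−1}^-, where λ_i = k_i if θ_{i−1} = 0 and λ_i = k̄_i if θ_{i−1} = 1. -/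
/-- The grading index: `θ i = 0` if `i ≤ n`, `θ i = 1` if `i > n`. -/
def thetaIdx (n i : ℕ) : ℕ := if i ≤ n then 0 else 1

/-- `p_i = θ_{i−1} + θ_i`. -/
def pIdx (n i : ℕ) : ℕ := thetaIdx n (i - 1) + thetaIdx n i

/-- The distinguished Cartan matrix of `sl(n+1|m)`:
`α_{ij} = (1+(−1)^{p_i})δ_{ij} − (−1)^{p_i}δ_{i,j−1} − δ_{i−1,j}`. -/
def alphaMat (n i j : ℕ) : ℤ :=
  (1 + (-1) ^ pIdx n i) * (if i = j then 1 else 0)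
    - (-1) ^ pIdx n i * (if i + 1 = j then 1 else 0)
    - (if i = j + 1 then 1 else 0)

/-- The `x`-deformed commutator `[u,v]_x = uv − x·vu`. -/
def cmx {K A : Type*} [Field K] [Ring A] [Algebra K A] (x : K) (u v : A) : A :=
  u * v - x • (v * u)

theorem h_kb {K A : Type*} [Field K] [Ring A] [Algebra K A] {k kb x : A} {c : K} (hc : c ≠ 0)
    (h1 : k * kb = 1) (h2 : kb * k = 1) (h : k * x = c • (x * k)) :
    kb * x = c⁻¹ • (x * kb) := by
  have h3 : kb * (k * x) * kb = c • (kb * x) := by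
    rw [h, mul_smul_comm, smul_mul_assoc, mul_assoc, mul_assoc, h1, mul_one]
  rw [← mul_assoc, h2, one_mul] at h3
  rw [h3, smul_smul, inv_mul_cancel₀ hc, one_smul]

/-- Diagonal step for the creation generators. -/
theorem h_diagP {K A : Type*} [Field K] [Ring A] [Algebra K A] {e f a k kb : A} {s c q r : K}
    (hef : e * f = s • (f * e) + c • (k - kb)) (hea : e * a = a * e)
    (hk : k * a = q • (a * k)) (hkb : kb * a = q⁻¹ • (a * kb)) :
    e * (f * a - r • (a * f)) - s • ((f * a - r • (a * f)) * e)
      = c • ((q - r) • (a * k) + (r - q⁻¹) • (a * kb)) := by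
  have h1 : e * (f * a) = s • (f * (a * e)) + c • (q • (a * k) - q⁻¹ • (a * kb)) := by
    rw [← mul_assoc, hef, add_mul, smul_mul_assoc, smul_mul_assoc, sub_mul, hk, hkb, mul_assoc, hea]
  have h2 : e * (a * f) = s • (a * (f * e)) + c • (a * k - a * kb) := by
    rw [← mul_assoc, hea, mul_assoc, hef, mul_add, mul_smul_comm, mul_smul_comm, mul_sub]
  rw [mul_sub, mul_smul_comm, h1, h2, sub_mul, smul_mul_assoc, mul_assoc, mul_assoc]
  module

/-- Diagonal step for the annihilation generators. -/
theorem h_diagM {K A : Type*} [Field K] [Ring A] [Algebra K A] {e f a k kb : A} {s c q r : K}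
    (hfe : f * e = s • (e * f) - (s * c) • (k - kb)) (hfa : f * a = a * f)
    (hk : a * k = q • (k * a)) (hkb : a * kb = q⁻¹ • (kb * a)) :
    f * (a * e - r • (e * a)) - s • ((a * e - r • (e * a)) * f)
      = -((s * c) • ((q - r) • (k * a) + (r - q⁻¹) • (kb * a))) := by
  have h1 : f * (e * a) = s • (e * (a * f)) - (s * c) • (k * a - kb * a) := by
    rw [← mul_assoc, hfe, sub_mul, smul_mul_assoc, smul_mul_assoc, sub_mul, mul_assoc, hfa]
  have h2 : f * (a * e) = s • (a * (e * f)) - (s * c) • (q • (k * a) - q⁻¹ • (kb * a)) := by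
    rw [← mul_assoc, hfa, mul_assoc, hfe, mul_sub, mul_smul_comm, mul_smul_comm, mul_sub, hk, hkb]
  rw [mul_sub, mul_smul_comm, h1, h2, sub_mul, smul_mul_assoc, mul_assoc, mul_assoc]
  module

/-- One step above the diagonal (creation). -/
theorem h_upP {K A : Type*} [Field K] [Ring A] [Algebra K A] {e f b a κ : A} {s r : K}
    (hef : e * f = f * e) (heb : e * b - s • (b * e) = a * κ) (hfa : f * a = a * f)
    (hκ : f * κ = r • (κ * f)) :
    e * (f * b - r • (b * f)) = s • ((f * b - r • (b * f)) * e) := by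
  have hb : e * b = s • (b * e) + a * κ := by rw [← heb]; abel
  have h1 : e * (f * b) = s • (f * (b * e)) + r • (a * (κ * f)) := by
    rw [← mul_assoc, hef, mul_assoc, hb, mul_add, mul_smul_comm, ← mul_assoc f a, hfa, mul_assoc a,
      hκ, mul_smul_comm]
  have h2 : e * (b * f) = s • (b * (f * e)) + a * (κ * f) := by
    rw [← mul_assoc, hb, add_mul, smul_mul_assoc, mul_assoc, hef, mul_assoc]
  rw [mul_sub, mul_smul_comm, h1, h2, sub_mul, smul_mul_assoc, mul_assoc, mul_assoc]
  module

/-- One step above the diagonal (annihilation). -/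
theorem h_upM {K A : Type*} [Field K] [Ring A] [Algebra K A] {e f b a lam : A} {s t r : K}
    (hfe : f * e = e * f) (hfb : f * b - s • (b * f) = -(t • (lam * a))) (hea : e * a = a * e)
    (hl : lam * e = r • (e * lam)) :
    f * (b * e - r • (e * b)) = s • ((b * e - r • (e * b)) * f) := by
  have hb : f * b = s • (b * f) - t • (lam * a) := by rw [eq_sub_iff_add_eq, ← sub_eq_zero] ; rw [← sub_eq_zero] at hfb; rw [← hfb]; abel
  have h1 : f * (b * e) = s • (b * (e * f)) - (t * r) • (e * (lam * a)) := by
    rw [← mul_assoc, hb, sub_mul, smul_mul_assoc, smul_mul_assoc, mul_assoc, hfe, mul_assoc lam,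
      ← hea, ← mul_assoc lam, hl, smul_mul_assoc, mul_assoc e, smul_smul]
  have h2 : f * (e * b) = s • (e * (b * f)) - t • (e * (lam * a)) := by
    rw [← mul_assoc, hfe, mul_assoc, hb, mul_sub, mul_smul_comm, mul_smul_comm]
  rw [mul_sub, mul_smul_comm, h1, h2, sub_mul, smul_mul_assoc, mul_assoc, mul_assoc]
  module

/-- Scalar commutation passes to q-commutators. -/
theorem h_stepP {K A : Type*} [Field K] [Ring A] [Algebra K A] {x f b : A} {s t r : K}
    (hf : x * f = t • (f * x)) (hb : x * b = s • (b * x)) :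
    x * (f * b - r • (b * f)) = (s * t) • ((f * b - r • (b * f)) * x) := by
  have h1 : x * (f * b) = (s * t) • (f * (b * x)) := by
    rw [← mul_assoc, hf, smul_mul_assoc, mul_assoc, hb, mul_smul_comm, smul_smul, mul_comm]
  have h2 : x * (b * f) = (s * t) • (b * (f * x)) := by
    rw [← mul_assoc, hb, smul_mul_assoc, mul_assoc, hf, mul_smul_comm, smul_smul]
  rw [mul_sub, mul_smul_comm, h1, h2, sub_mul, smul_mul_assoc, mul_assoc, mul_assoc]
  module

theorem h_p_even {n i : ℕ} (h0 : 1 ≤ i) (h : i ≠ n + 1) : Even (pIdx n i) := by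
  unfold pIdx thetaIdx
  split_ifs <;> first | omega | decide

theorem h_p_one (n : ℕ) : pIdx n (n + 1) = 1 := by simp [pIdx, thetaIdx]

/-- The sign `(-1)^{p_i}`. -/
def sgnP (K : Type*) [Field K] (n i : ℕ) : K := if i = n + 1 then -1 else 1

theorem h_sgn {K : Type*} [Field K] {n i : ℕ} (h0 : 1 ≤ i) : (-1 : K) ^ pIdx n i = sgnP K n i := by
  unfold sgnP
  split_ifs with h
  · rw [h, h_p_one, pow_one]
  · exact (h_p_even h0 h).neg_one_pow

theorem h_sgn_self {K : Type*} [Field K] {n i : ℕ} (h0 : 1 ≤ i) :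
    (-1 : K) ^ (pIdx n i * pIdx n i) = sgnP K n i := by
  unfold sgnP
  split_ifs with h
  · rw [h, h_p_one, mul_one, pow_one]
  · exact ((h_p_even h0 h).mul_left _).neg_one_pow

theorem h_sgn_ne {K : Type*} [Field K] {n i j : ℕ} (h0 : 1 ≤ i) (h1 : 1 ≤ j) (hij : i ≠ j) :
    (-1 : K) ^ (pIdx n i * pIdx n j) = 1 := by
  apply Even.neg_one_pow
  by_cases h : i = n + 1
  · exact (h_p_even h1 (by omega)).mul_left _
  · exact (h_p_even h0 h).mul_right _

theorem h_sgn_lt {K : Type*} [Field K] {n i j : ℕ} (h0 : 1 ≤ i) (hij : j < i) :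
    (-1 : K) ^ (pIdx n i * thetaIdx n j) = 1 := by
  apply Even.neg_one_pow
  by_cases h : i = n + 1
  · have : thetaIdx n j = 0 := by unfold thetaIdx; rw [if_pos (by omega)]
    simp [this]
  · exact (h_p_even h0 h).mul_right _

theorem h_sgn_ge {K : Type*} [Field K] {n i j : ℕ} (h0 : 1 ≤ i) (hij : i ≤ j) :
    (-1 : K) ^ (pIdx n i * thetaIdx n j) = sgnP K n i := by
  unfold sgnP
  split_ifs with h
  · have : thetaIdx n j = 1 := by unfold thetaIdx; rw [if_neg (by omega)]
    rw [this, h, h_p_one]; simp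
  · exact ((h_p_even h0 h).mul_right _).neg_one_pow

theorem h_sgn_sq {K : Type*} [Field K] {n i : ℕ} : sgnP K n i * sgnP K n i = 1 := by
  unfold sgnP; split_ifs <;> simp

theorem h_al_far {n i j : ℕ} (h : j + 1 < i) : alphaMat n i j = 0 := by
  unfold alphaMat
  rw [if_neg (by omega), if_neg (by omega), if_neg (by omega)]; simp

theorem h_al_low {n i j : ℕ} (h : i = j + 1) : alphaMat n i j = -1 := by
  unfold alphaMat
  rw [if_neg (by omega), if_neg (by omega), if_pos h]; simp

theorem h_al_up {n i : ℕ} (h : 1 ≤ i) :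
    alphaMat n i (i + 1) = if i = n + 1 then 1 else -1 := by
  unfold alphaMat
  rw [if_neg (by omega), if_pos rfl, if_neg (by omega)]
  split_ifs with h1
  · rw [h1, h_p_one]; norm_num
  · rw [(h_p_even h h1).neg_one_pow]; norm_num

/-- Proposition 2, relations (28c) and (28d). -/
theorem stmt11
    (K : Type*) (A : Type*) [Field K] [Ring A] [Algebra K A]
    (n m : ℕ) (hm : 1 ≤ m)
    (q : K) (hq0 : q ≠ 0) (hq1 : q ^ 2 ≠ 1)
    (qc : ℕ → K) (hqc : ∀ i, qc i = if i ≤ n then q else q⁻¹)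
    (e f k kb : ℕ → A)
    -- k_i k̄_i = k̄_i k_i = 1
    (hkinv : ∀ i, 1 ≤ i → i ≤ n + m → k i * kb i = 1 ∧ kb i * k i = 1)
    -- k_i k_j = k_j k_i
    (hkk : ∀ i j, 1 ≤ i → i ≤ n + m → 1 ≤ j → j ≤ n + m → k i * k j = k j * k i)
    -- k_i e_j = q^{α_{ij}} e_j k_i
    (hke : ∀ i j, 1 ≤ i → i ≤ n + m → 1 ≤ j → j ≤ n + m →
      k i * e j = (q ^ alphaMat n i j) • (e j * k i))
    -- k_i f_j = q^{−α_{ij}} f_j k_i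
    (hkf : ∀ i j, 1 ≤ i → i ≤ n + m → 1 ≤ j → j ≤ n + m →
      k i * f j = (q ^ (-alphaMat n i j)) • (f j * k i))
    -- e_i f_j − (−1)^{p_i p_j} f_j e_i = δ_{ij}(q−q̄)⁻¹(k_i−k̄_i)
    (hef : ∀ i j, 1 ≤ i → i ≤ n + m → 1 ≤ j → j ≤ n + m →
      e i * f j - ((-1 : K) ^ (pIdx n i * pIdx n j)) • (f j * e i)
        = (if i = j then (q - q⁻¹)⁻¹ else 0) • (k i - kb i))
    -- e_i e_j = e_j e_i and f_i f_j = f_j f_i for |i−j| ≠ 1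
    (hee : ∀ i j, 1 ≤ i → i ≤ n + m → 1 ≤ j → j ≤ n + m → i ≠ j + 1 → j ≠ i + 1 →
      e i * e j = e j * e i)
    (hff : ∀ i j, 1 ≤ i → i ≤ n + m → 1 ≤ j → j ≤ n + m → i ≠ j + 1 → j ≠ i + 1 →
      f i * f j = f j * f i)
    -- e_{n+1}² = f_{n+1}² = 0
    (hesq : n + 1 ≤ n + m → e (n + 1) * e (n + 1) = 0)
    (hfsq : n + 1 ≤ n + m → f (n + 1) * f (n + 1) = 0)
    -- triple Serre relations
    (heSerre : ∀ i j, 1 ≤ i → i ≤ n + m → 1 ≤ j → j ≤ n + m → i ≠ n + 1 →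
      (j = i + 1 ∨ i = j + 1) →
      cmx q (e i) (cmx q⁻¹ (e i) (e j)) = 0 ∧ cmx q⁻¹ (e i) (cmx q (e i) (e j)) = 0)
    (hfSerre : ∀ i j, 1 ≤ i → i ≤ n + m → 1 ≤ j → j ≤ n + m → i ≠ n + 1 →
      (j = i + 1 ∨ i = j + 1) →
      cmx q (f i) (cmx q⁻¹ (f i) (f j)) = 0 ∧ cmx q⁻¹ (f i) (cmx q (f i) (f j)) = 0)
    -- additional Serre relations
    (heAdd : 1 ≤ n → n + 2 ≤ n + m →
      e (n + 1) * cmx q⁻¹ (cmx q (e n) (e (n + 1))) (e (n + 2))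
          + cmx q⁻¹ (cmx q (e n) (e (n + 1))) (e (n + 2)) * e (n + 1) = 0 ∧
      e (n + 1) * cmx q (cmx q⁻¹ (e n) (e (n + 1))) (e (n + 2))
          + cmx q (cmx q⁻¹ (e n) (e (n + 1))) (e (n + 2)) * e (n + 1) = 0)
    (hfAdd : 1 ≤ n → n + 2 ≤ n + m →
      f (n + 1) * cmx q⁻¹ (cmx q (f n) (f (n + 1))) (f (n + 2))
          + cmx q⁻¹ (cmx q (f n) (f (n + 1))) (f (n + 2)) * f (n + 1) = 0 ∧
      f (n + 1) * cmx q (cmx q⁻¹ (f n) (f (n + 1))) (f (n + 2))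
          + cmx q (cmx q⁻¹ (f n) (f (n + 1))) (f (n + 2)) * f (n + 1) = 0)
    -- the deformed creation and annihilation generators
    (aP aM : ℕ → A)
    (haM1 : aM 1 = e 1) (haP1 : aP 1 = f 1)
    (haM : ∀ i, 2 ≤ i → i ≤ n + m →
      aM i = aM (i - 1) * e i - (qc (i - 1))⁻¹ • (e i * aM (i - 1)))
    (haP : ∀ i, 2 ≤ i → i ≤ n + m →
      aP i = f i * aP (i - 1) - qc (i - 1) • (aP (i - 1) * f i))
    -- L_i = ∏_{p=1}^{i} k_p^{(−1)^{θ_{p−1}}} and its inverse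
    (L Lb : ℕ → A)
    (hL1 : L 1 = k 1) (hLb1 : Lb 1 = kb 1)
    (hL : ∀ i, 2 ≤ i → i ≤ n + m →
      L i = L (i - 1) * (if thetaIdx n (i - 1) = 0 then k i else kb i))
    (hLb : ∀ i, 2 ≤ i → i ≤ n + m →
      Lb i = Lb (i - 1) * (if thetaIdx n (i - 1) = 0 then kb i else k i))
    :
    ∀ i j : ℕ, 2 ≤ i → i ≤ n + m → 1 ≤ j → j ≤ n + m →
      (e i * aP j - ((-1 : K) ^ (pIdx n i * thetaIdx n j)) • (aP j * e i)
        = (if i = j then (1 : K) else 0) •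
            (aP (i - 1) * (if thetaIdx n (i - 1) = 0 then kb i else k i))) ∧
      (f i * aM j - ((-1 : K) ^ (pIdx n i * thetaIdx n j)) • (aM j * f i)
        = -((((-1 : K) ^ pIdx n i) * (if i = j then 1 else 0)) •
            ((if thetaIdx n (i - 1) = 0 then k i else kb i) * aM (i - 1)))) := by
  have hqd : q - q⁻¹ ≠ 0 := by
    intro h
    apply hq1
    field_simp at h
    linear_combination h
  have hef_ne : ∀ i j, 1 ≤ i → i ≤ n + m → 1 ≤ j → j ≤ n + m → i ≠ j →
      e i * f j = f j * e i := by
    intro i j h1 h2 h3 h4 h5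
    have := hef i j h1 h2 h3 h4
    rw [h_sgn_ne h1 h3 h5, if_neg h5, zero_smul, one_smul, sub_eq_zero] at this
    exact this
  have hef_eq : ∀ i, 1 ≤ i → i ≤ n + m →
      e i * f i = sgnP K n i • (f i * e i) + (q - q⁻¹)⁻¹ • (k i - kb i) := by
    intro i h1 h2
    have := hef i i h1 h2 h1 h2
    rw [h_sgn_self h1, if_pos rfl] at this
    rw [← this]; abel
  have hfe_eq : ∀ i, 1 ≤ i → i ≤ n + m →
      f i * e i = sgnP K n i • (e i * f i) - (sgnP K n i * (q - q⁻¹)⁻¹) • (k i - kb i) := by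
    intro i h1 h2
    rw [hef_eq i h1 h2, smul_add, smul_smul, smul_smul, h_sgn_sq, one_smul]
    abel
  -- a_i^± as one step
  have haP' : ∀ j, 1 ≤ j → j + 1 ≤ n + m →
      aP (j + 1) = f (j + 1) * aP j - qc j • (aP j * f (j + 1)) := by
    intro j h1 h2
    simpa using haP (j + 1) (by omega) h2
  have haM' : ∀ j, 1 ≤ j → j + 1 ≤ n + m →
      aM (j + 1) = aM j * e (j + 1) - (qc j)⁻¹ • (e (j + 1) * aM j) := by
    intro j h1 h2
    simpa using haM (j + 1) (by omega) h2
  -- generic: an element commuting with the generators f_1..f_j commutes with aP j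
  have hcP : ∀ x : A, ∀ j, 1 ≤ j → j ≤ n + m →
      (∀ l, 1 ≤ l → l ≤ j → Commute x (f l)) → Commute x (aP j) := by
    intro x j h1
    induction j, h1 using Nat.le_induction with
    | base => intro _ h; rw [haP1]; exact h 1 le_rfl le_rfl
    | succ j h1 ih =>
      intro h2 h
      have hb := ih (by omega) (fun l hl hl' => h l hl (by omega))
      have hf := h (j + 1) (by omega) le_rfl
      rw [haP' j h1 h2]
      exact (hf.mul_right hb).sub_right ((hb.mul_right hf).smul_right _)
  have hcM : ∀ x : A, ∀ j, 1 ≤ j → j ≤ n + m →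
      (∀ l, 1 ≤ l → l ≤ j → Commute x (e l)) → Commute x (aM j) := by
    intro x j h1
    induction j, h1 using Nat.le_induction with
    | base => intro _ h; rw [haM1]; exact h 1 le_rfl le_rfl
    | succ j h1 ih =>
      intro h2 h
      have hb := ih (by omega) (fun l hl hl' => h l hl (by omega))
      have hf := h (j + 1) (by omega) le_rfl
      rw [haM' j h1 h2]
      exact (hb.mul_right hf).sub_right ((hf.mul_right hb).smul_right _)
  -- k_{j+1} against a_j
  have hkaP : ∀ j, 1 ≤ j → j + 1 ≤ n + m → k (j + 1) * aP j = q • (aP j * k (j + 1)) := by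
    intro j h1 h2
    have hf : k (j + 1) * f j = q • (f j * k (j + 1)) := by
      rw [hkf (j + 1) j (by omega) h2 h1 (by omega), h_al_low rfl, neg_neg, zpow_one]
    rcases Nat.lt_or_ge 1 j with h | h
    · obtain ⟨l, rfl⟩ : ∃ l, j = l + 1 := ⟨j - 1, by omega⟩
      have hb : k (l + 1 + 1) * aP l = (1 : K) • (aP l * k (l + 1 + 1)) := by
        rw [one_smul]
        refine hcP _ l (by omega) (by omega) (fun r hr hr' => ?_)
        have := hkf (l + 1 + 1) r (by omega) h2 hr (by omega)
        rw [h_al_far (by omega), neg_zero, zpow_zero, one_smul] at this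
        exact this
      have := h_stepP (r := qc l) hf hb
      rwa [← haP' l (by omega) (by omega), one_mul] at this
    · obtain rfl : j = 1 := by omega
      rw [haP1]; exact hf
  have hkaM : ∀ j, 1 ≤ j → j + 1 ≤ n + m → k (j + 1) * aM j = q⁻¹ • (aM j * k (j + 1)) := by
    intro j h1 h2
    have hf : k (j + 1) * e j = q⁻¹ • (e j * k (j + 1)) := by
      rw [hke (j + 1) j (by omega) h2 h1 (by omega), h_al_low rfl, zpow_neg_one]
    rcases Nat.lt_or_ge 1 j with h | h
    · obtain ⟨l, rfl⟩ : ∃ l, j = l + 1 := ⟨j - 1, by omega⟩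
      have hb : k (l + 1 + 1) * aM l = (1 : K) • (aM l * k (l + 1 + 1)) := by
        rw [one_smul]
        refine hcM _ l (by omega) (by omega) (fun r hr hr' => ?_)
        have := hke (l + 1 + 1) r (by omega) h2 hr (by omega)
        rw [h_al_far (by omega), zpow_zero, one_smul] at this
        exact this
      have hr : qc l ≠ 0 := by rw [hqc]; split_ifs <;> simp [hq0]
      have := h_stepP (r := qc l) hb hf
      have h5 : aM l * e (l + 1) - (qc l)⁻¹ • (e (l + 1) * aM l) = aM (l + 1) :=
        (haM' l (by omega) (by omega)).symm
      have := h_stepP (r := (qc l)⁻¹) hb hf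
      rwa [h5, mul_one] at this
    · obtain rfl : j = 1 := by omega
      rw [haM1]; exact hf
  -- commutation below the diagonal
  have hlowP : ∀ i j, 1 ≤ j → j < i → i ≤ n + m → e i * aP j = aP j * e i := by
    intro i j h1 h2 h3
    exact hcP _ j h1 (by omega) (fun l hl hl' =>
      hef_ne i l (by omega) h3 hl (by omega) (by omega))
  have hlowM : ∀ i j, 1 ≤ j → j < i → i ≤ n + m → f i * aM j = aM j * f i := by
    intro i j h1 h2 h3
    exact hcM _ j h1 (by omega) (fun l hl hl' =>
      (hef_ne l i hl (by omega) (by omega) (by omega) (by omega)).symm)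
  -- diagonal
  have hdiagP : ∀ i, 1 ≤ i → i + 1 ≤ n + m →
      e (i + 1) * aP (i + 1) - sgnP K n (i + 1) • (aP (i + 1) * e (i + 1))
        = aP i * (if i ≤ n then kb (i + 1) else k (i + 1)) := by
    intro i h1 h2
    obtain ⟨hk1, hk2⟩ := hkinv (i + 1) (by omega) h2
    have hk := hkaP i h1 h2
    have := h_diagP (r := qc i) (hef_eq (i + 1) (by omega) h2) (hlowP (i + 1) i h1 (by omega) h2) hk
      (h_kb hq0 hk1 hk2 hk)
    rw [haP' i h1 h2, this, hqc]
    split_ifs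
    · rw [sub_self, zero_smul, zero_add, smul_smul, inv_mul_cancel₀ hqd, one_smul]
    · rw [sub_self, zero_smul, add_zero, smul_smul, inv_mul_cancel₀ hqd, one_smul]
  have hdiagM : ∀ i, 1 ≤ i → i + 1 ≤ n + m →
      f (i + 1) * aM (i + 1) - sgnP K n (i + 1) • (aM (i + 1) * f (i + 1))
        = -(sgnP K n (i + 1) • ((if i ≤ n then k (i + 1) else kb (i + 1)) * aM i)) := by
    intro i h1 h2
    obtain ⟨hk1, hk2⟩ := hkinv (i + 1) (by omega) h2
    have hk := hkaM i h1 h2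
    have hk' := h_kb (inv_ne_zero hq0) hk1 hk2 hk
    have hA : aM i * k (i + 1) = q • (k (i + 1) * aM i) := by
      rw [hk, smul_smul, mul_inv_cancel₀ hq0, one_smul]
    have hB : aM i * kb (i + 1) = q⁻¹ • (kb (i + 1) * aM i) := by
      rw [hk', inv_inv, smul_smul, inv_mul_cancel₀ hq0, one_smul]
    have := h_diagM (r := (qc i)⁻¹) (hfe_eq (i + 1) (by omega) h2)
      (hlowM (i + 1) i h1 (by omega) h2) hA hB
    rw [haM' i h1 h2, this, hqc]
    split_ifs
    · rw [sub_self, zero_smul, add_zero, smul_smul, mul_assoc, inv_mul_cancel₀ hqd, mul_one]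
    · rw [inv_inv, sub_self, zero_smul, zero_add, smul_smul, mul_assoc, inv_mul_cancel₀ hqd,
        mul_one]
  -- above the diagonal
  have hupP : ∀ i j, 2 ≤ i → i + 1 ≤ j → j ≤ n + m → e i * aP j = sgnP K n i • (aP j * e i) := by
    intro i j hi hij
    induction j, hij using Nat.le_induction with
    | base =>
      intro h2
      obtain ⟨l, rfl⟩ : ∃ l, i = l + 1 := ⟨i - 1, by omega⟩
      obtain ⟨hk1, hk2⟩ := hkinv (l + 1) (by omega) (by omega)
      have hk := hkf (l + 1) (l + 1 + 1) (by omega) (by omega) (by omega) h2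
      have hne : q ^ (-alphaMat n (l + 1) (l + 1 + 1)) ≠ 0 := zpow_ne_zero _ hq0
      have hk' := h_kb hne hk1 hk2 hk
      rw [haP' (l + 1) (by omega) h2]
      refine h_upP (hef_ne _ _ (by omega) (by omega) (by omega) h2 (by omega))
        (hdiagP l (by omega) (by omega)) ?_ ?_
      · exact hcP _ l (by omega) (by omega) (fun r hr hr' =>
          hff _ _ (by omega) h2 hr (by omega) (by omega) (by omega))
      · rw [h_al_up (by omega)] at hk hk'
        rw [hqc]
        by_cases c1 : l ≤ n
        · by_cases c2 : l = n
          · rw [if_pos c1, hk', if_neg (by omega), if_pos (by omega), smul_smul]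
            simp [hq0]
          · rw [if_pos c1, hk', if_pos (by omega), if_neg (by omega), smul_smul]
            simp [hq0]
        · rw [if_neg c1, hk, if_neg (by omega), if_neg (by omega), smul_smul]
          simp [hq0]
    | succ j hij ih =>
      intro h2
      have hf : e i * f (j + 1) = (1 : K) • (f (j + 1) * e i) := by
        rw [one_smul]
        exact hef_ne _ _ (by omega) (by omega) (by omega) h2 (by omega)
      have := h_stepP (r := qc j) hf (ih (by omega))
      rwa [← haP' j (by omega) h2, mul_one] at this
  have hupM : ∀ i j, 2 ≤ i → i + 1 ≤ j → j ≤ n + m → f i * aM j = sgnP K n i • (aM j * f i) := by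
    intro i j hi hij
    induction j, hij using Nat.le_induction with
    | base =>
      intro h2
      obtain ⟨l, rfl⟩ : ∃ l, i = l + 1 := ⟨i - 1, by omega⟩
      obtain ⟨hk1, hk2⟩ := hkinv (l + 1) (by omega) (by omega)
      have hk := hke (l + 1) (l + 1 + 1) (by omega) (by omega) (by omega) h2
      have hne : q ^ (alphaMat n (l + 1) (l + 1 + 1)) ≠ 0 := zpow_ne_zero _ hq0
      have hk' := h_kb hne hk1 hk2 hk
      rw [haM' (l + 1) (by omega) h2]
      refine h_upM (hef_ne _ _ (by omega) h2 (by omega) (by omega) (by omega)).symm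
        (hdiagM l (by omega) (by omega)) ?_ ?_
      · exact hcM _ l (by omega) (by omega) (fun r hr hr' =>
          hee _ _ (by omega) h2 hr (by omega) (by omega) (by omega))
      · rw [h_al_up (by omega)] at hk hk'
        rw [hqc]
        by_cases c1 : l ≤ n
        · by_cases c2 : l = n
          · rw [if_pos c1, hk, if_neg (show ¬ l + 1 ≤ n by omega), if_pos (show l + 1 = n + 1 by omega)]
            simp
          · rw [if_pos c1, hk, if_pos (show l + 1 ≤ n by omega), if_neg (show ¬ l + 1 = n + 1 by omega)]
            simp
        · rw [if_neg c1, hk', if_neg (by omega), if_neg (by omega)]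
          simp
    | succ j hij ih =>
      intro h2
      have hf : f i * e (j + 1) = (1 : K) • (e (j + 1) * f i) := by
        rw [one_smul]
        exact (hef_ne _ _ (by omega) h2 (by omega) (by omega) (by omega)).symm
      have := h_stepP (r := (qc j)⁻¹) (ih (by omega)) hf
      rwa [← haM' j (by omega) h2, one_mul] at this
  intro i j hi hiN hj hjN
  rcases lt_trichotomy j i with h | h | h
  · rw [h_sgn_lt (by omega) h, if_neg (show ¬ i = j by omega), hlowP i j hj h hiN,
      hlowM i j hj h hiN]
    simp
  · subst h
    obtain ⟨l, rfl⟩ : ∃ l, j = l + 1 := ⟨j - 1, by omega⟩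
    rw [h_sgn_ge (by omega) le_rfl, hdiagP l (by omega) hjN, hdiagM l (by omega) hjN,
      h_sgn (by omega)]
    simp [thetaIdx]
  · rw [h_sgn_ge (by omega) h.le, if_neg (show ¬ i = j by omega), hupP i j hi h hjN,
      hupM i j hi h hjN]
    simp
end

section
/- (Relations (35).) For all 1 ≤ i ≤ N: a_i^-·a_i^+ − (−1)^{θ_i}·a_i^+·a_i^- = (q − q̄)⁻¹·(L_i − L̄_i); and for all 1 ≤ i ≤ N−1: a_i^-·a_{i+1}^+ − (−1)^{θ_iθ_{i+1}}·a_{i+1}^+·a_i^- = −(−1)^{θ_i}·L_i·f_{i+1} and a_{i+1}^-·a_i^+ − (−1)^{θ_iθ_{i+1}}·a_i^+·a_{i+1}^- = −(−1)^{θ_i}·e_{i+1}·L̄_i. -/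
/-- `x` and `y` commute up to the scalar `c`. -/
def QCom {K A : Type*} [Field K] [Ring A] [Algebra K A] (c : K) (x y : A) : Prop :=
  x * y = c • (y * x)

section helpers
variable {K A : Type*} [Field K] [Ring A] [Algebra K A]

theorem QCom.mul_right {c d : K} {x y z : A} (h1 : QCom c x y) (h2 : QCom d x z) :
    QCom (c * d) x (y * z) := by
  unfold QCom at *
  rw [← mul_assoc, h1, smul_mul_assoc, mul_assoc, h2, mul_smul_comm, smul_smul, mul_assoc]

theorem QCom.mul_left {c d : K} {x y z : A} (h1 : QCom c x z) (h2 : QCom d y z) :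
    QCom (c * d) (x * y) z := by
  unfold QCom at *
  rw [mul_assoc, h2, mul_smul_comm, ← mul_assoc, h1, smul_mul_assoc, smul_smul, mul_assoc,
    mul_comm d c]

theorem QCom.sub_smul_right {c r : K} {x y z : A} (h1 : QCom c x y) (h2 : QCom c x z) :
    QCom c x (y - r • z) := by
  unfold QCom at *
  rw [mul_sub, mul_smul_comm, h1, h2, sub_mul, smul_mul_assoc, smul_sub, smul_comm]

theorem QCom.sub_smul_left {c r : K} {x y z : A} (h1 : QCom c x z) (h2 : QCom c y z) :
    QCom c (x - r • y) z := by
  unfold QCom at *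
  rw [sub_mul, smul_mul_assoc, h1, h2, mul_sub, mul_smul_comm, smul_sub, smul_comm]

theorem QCom.inv_left {c : K} {x xb y : A} (hc : c ≠ 0) (h1 : QCom c x y) (ha : x * xb = 1)
    (hb : xb * x = 1) : QCom c⁻¹ xb y := by
  unfold QCom at *
  have : xb * (x * y) * xb = c • (xb * (y * x) * xb) := by
    rw [h1, mul_smul_comm, smul_mul_assoc]
  rw [← mul_assoc, hb, one_mul, mul_assoc, mul_assoc, ha, mul_one] at this
  rw [this, smul_smul, inv_mul_cancel₀ hc, one_smul]

theorem QCom.comm_braid {d c r : K} {x y z : A} (h1 : QCom c x y) (h2 : QCom d x z) :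
    QCom (c * d) x (y * z - r • (z * y)) :=
  (h1.mul_right h2).sub_smul_right (by rw [mul_comm]; exact h2.mul_right h1)

theorem QCom.braid_comm {d c r : K} {x y z : A} (h1 : QCom c y x) (h2 : QCom d z x) :
    QCom (c * d) (y * z - r • (z * y)) x :=
  (h1.mul_left h2).sub_smul_left (by rw [mul_comm]; exact h2.mul_left h1)

/-- Second relation, one step. -/
theorem step_two (Q c s : K) (hc : c * (Q⁻¹ - Q) = -s) (hQ : Q ≠ 0) (aM aP L Lb f : A)
    (h : aM * aP - s • (aP * aM) = c • (L - Lb))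
    (hf : aM * f = f * aM) (hL : QCom Q L f) (hLb : QCom Q⁻¹ Lb f) :
    aM * (f * aP - Q • (aP * f)) - s • ((f * aP - Q • (aP * f)) * aM) = -(s • (L * f)) := by
  unfold QCom at *
  have h0 : aM * aP = s • (aP * aM) + c • (L - Lb) := by rw [← h]; abel
  have e1 : aM * (f * aP) = s • (f * aP * aM) + c • (f * L - f * Lb) := by
    rw [← mul_assoc, hf, mul_assoc, h0, mul_add, mul_smul_comm, mul_smul_comm, mul_sub, mul_assoc]
  have e2 : aM * (aP * f) = s • (aP * f * aM) + c • (L * f - Lb * f) := by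
    rw [← mul_assoc, h0, add_mul, smul_mul_assoc, smul_mul_assoc, sub_mul, mul_assoc, hf,
      mul_assoc]
  have hs : s = c * (Q - Q⁻¹) := by linear_combination hc
  rw [mul_sub, mul_smul_comm, e1, e2, sub_mul, smul_mul_assoc, hL, hLb]
  rw [hs]
  match_scalars <;> field_simp <;> ring

/-- Third relation, one step. -/
theorem step_three (Q c s : K) (hc : c * (Q⁻¹ - Q) = -s) (hQ : Q ≠ 0) (aM aP L Lb e : A)
    (h : aM * aP - s • (aP * aM) = c • (L - Lb))
    (he : e * aP = aP * e) (hL : QCom Q⁻¹ L e) (hLb : QCom Q Lb e) :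
    (aM * e - Q⁻¹ • (e * aM)) * aP - s • (aP * (aM * e - Q⁻¹ • (e * aM))) = -(s • (e * Lb)) := by
  unfold QCom at *
  have h0 : aM * aP = s • (aP * aM) + c • (L - Lb) := by rw [← h]; abel
  have e1 : aM * e * aP = s • (aP * (aM * e)) + c • (L * e - Lb * e) := by
    rw [mul_assoc, he, ← mul_assoc, h0, add_mul, smul_mul_assoc, smul_mul_assoc, sub_mul, mul_assoc]
  have e2 : e * aM * aP = s • (aP * (e * aM)) + c • (e * L - e * Lb) := by
    rw [mul_assoc, h0, mul_add, mul_smul_comm, mul_smul_comm, mul_sub, ← mul_assoc, he,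
      mul_assoc]
  have hs : s = c * (Q - Q⁻¹) := by linear_combination hc
  rw [sub_mul, smul_mul_assoc, e1, e2, mul_sub, mul_smul_comm, hL, hLb]
  rw [hs]
  match_scalars <;> field_simp <;> ring

/-- First relation, one step. -/
theorem step_one (Q c s p : K) (hQ : Q ≠ 0) (aM aP L Lb e f k kb kap : A)
    (h : aM * aP - s • (aP * aM) = c • (L - Lb))
    (h2 : aM * (f * aP - Q • (aP * f)) - s • ((f * aP - Q • (aP * f)) * aM) = -(s • (L * f)))
    (he : e * aP = aP * e) (hL : QCom Q⁻¹ L e)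
    (hef : e * f - p • (f * e) = c • (k - kb))
    (hk : c • ((k - kb) * aP) - (c * Q) • (aP * (k - kb)) = aP * kap)
    (hkap : QCom Q kap aM) :
    (aM * e - Q⁻¹ • (e * aM)) * (f * aP - Q • (aP * f))
      - (p * s) • ((f * aP - Q • (aP * f)) * (aM * e - Q⁻¹ • (e * aM)))
      = (c * s) • (L * (k - kb)) + c • ((L - Lb) * kap) := by
  have hP : e * (f * aP - Q • (aP * f)) = p • ((f * aP - Q • (aP * f)) * e) + aP * kap := by
    have h0 : e * f = p • (f * e) + c • (k - kb) := by rw [← hef]; abel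
    rw [← hk, mul_sub, mul_smul_comm, ← mul_assoc, ← mul_assoc, he, h0, mul_assoc aP e f, h0,
      add_mul, mul_add, smul_mul_assoc, mul_assoc f e aP, he]
    simp only [sub_mul, mul_smul_comm, smul_mul_assoc, mul_assoc]
    module
  generalize f * aP - Q • (aP * f) = P at *
  unfold QCom at *
  have h2' : aM * P = s • (P * aM) - s • (L * f) := by
    rw [sub_eq_iff_eq_add] at h2; rw [h2]; abel
  have eL : e * L = Q • (L * e) := by rw [hL, smul_smul, mul_inv_cancel₀ hQ, one_smul]
  have t1 : aM * e * P = p • (s • (P * (aM * e)) - s • (L * (f * e))) + aM * aP * kap := by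
    rw [mul_assoc, hP, mul_add, mul_smul_comm, ← mul_assoc, h2', ← mul_assoc, sub_mul,
      smul_mul_assoc, smul_mul_assoc, mul_assoc, mul_assoc]
  have t2 : e * aM * P = s • (p • (P * (e * aM)) + Q • (aP * aM * kap)) - (s * Q) • (L * (e * f)) := by
    rw [mul_assoc, h2', mul_sub, mul_smul_comm, mul_smul_comm, ← mul_assoc, hP, ← mul_assoc e L f,
      eL, add_mul, smul_mul_assoc, mul_assoc aP kap aM, hkap, mul_smul_comm, smul_mul_assoc,
      smul_smul s Q]
    simp only [mul_assoc]
  have h3 : c • ((L - Lb) * kap) = aM * aP * kap - s • (aP * aM * kap) := by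
    rw [← smul_mul_assoc, ← h, sub_mul, smul_mul_assoc]
  have h4 : (c * s) • (L * (k - kb)) = s • (L * (e * f)) - (s * p) • (L * (f * e)) := by
    rw [mul_comm c s, ← smul_smul, ← mul_smul_comm c, ← hef, mul_sub, mul_smul_comm, smul_sub,
      smul_smul]
  rw [h3, h4, sub_mul, smul_mul_assoc, t1, t2, mul_sub, mul_smul_comm]
  match_scalars <;> field_simp <;> ring

end helpers

theorem thetaIdx_le {n i : ℕ} (h : i ≤ n) : thetaIdx n i = 0 := by simp [thetaIdx, h]

theorem thetaIdx_gt {n i : ℕ} (h : n < i) : thetaIdx n i = 1 := by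
  simp [thetaIdx, h]

theorem pIdx_le {n i : ℕ} (h : i ≤ n) : pIdx n i = 0 := by
  simp [pIdx, thetaIdx_le h, thetaIdx_le (show i - 1 ≤ n by omega)]

theorem pIdx_eq {n : ℕ} : pIdx n (n + 1) = 1 := by
  simp [pIdx, thetaIdx]

theorem pIdx_gt {n i : ℕ} (h : n + 1 < i) : pIdx n i = 2 := by
  simp [pIdx, thetaIdx_gt (show n < i by omega), thetaIdx_gt (show n < i - 1 by omega)]

theorem pIdx_even {n i j : ℕ} (h : i ≠ j) : Even (pIdx n i * pIdx n j) := by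
  rcases lt_trichotomy i (n + 1) with hi | hi | hi
  · rw [pIdx_le (by omega)]; simp
  · subst hi
    rcases lt_trichotomy j (n + 1) with hj | hj | hj
    · rw [pIdx_le (i := j) (by omega)]; simp
    · omega
    · rw [pIdx_gt hj]; simp
  · rw [pIdx_gt hi]; simp

theorem alphaMat_far {n i j : ℕ} (h : i + 2 ≤ j ∨ j + 2 ≤ i) : alphaMat n i j = 0 := by
  unfold alphaMat
  rw [if_neg (by omega), if_neg (by omega), if_neg (by omega)]; simp

theorem alphaMat_down {n i : ℕ} : alphaMat n (i + 1) i = -1 := by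
  unfold alphaMat
  rw [if_neg (by omega), if_neg (by omega), if_pos rfl]; simp

theorem alphaMat_up {n i : ℕ} : alphaMat n i (i + 1) = -(-1) ^ pIdx n i := by
  unfold alphaMat
  rw [if_neg (by omega), if_pos rfl, if_neg (by omega)]; simp

/-- Relations (35). -/
theorem stmt12
    (K : Type*) (A : Type*) [Field K] [Ring A] [Algebra K A]
    (n m : ℕ) (hm : 1 ≤ m)
    (q : K) (hq0 : q ≠ 0) (hq1 : q ^ 2 ≠ 1)
    (qc : ℕ → K) (hqc : ∀ i, qc i = if i ≤ n then q else q⁻¹)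
    (e f k kb : ℕ → A)
    -- k_i k̄_i = k̄_i k_i = 1
    (hkinv : ∀ i, 1 ≤ i → i ≤ n + m → k i * kb i = 1 ∧ kb i * k i = 1)
    -- k_i k_j = k_j k_i
    (hkk : ∀ i j, 1 ≤ i → i ≤ n + m → 1 ≤ j → j ≤ n + m → k i * k j = k j * k i)
    -- k_i e_j = q^{α_{ij}} e_j k_i
    (hke : ∀ i j, 1 ≤ i → i ≤ n + m → 1 ≤ j → j ≤ n + m →
      k i * e j = (q ^ alphaMat n i j) • (e j * k i))
    -- k_i f_j = q^{−α_{ij}} f_j k_i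
    (hkf : ∀ i j, 1 ≤ i → i ≤ n + m → 1 ≤ j → j ≤ n + m →
      k i * f j = (q ^ (-alphaMat n i j)) • (f j * k i))
    -- e_i f_j − (−1)^{p_i p_j} f_j e_i = δ_{ij}(q−q̄)⁻¹(k_i−k̄_i)
    (hef : ∀ i j, 1 ≤ i → i ≤ n + m → 1 ≤ j → j ≤ n + m →
      e i * f j - ((-1 : K) ^ (pIdx n i * pIdx n j)) • (f j * e i)
        = (if i = j then (q - q⁻¹)⁻¹ else 0) • (k i - kb i))
    -- e_i e_j = e_j e_i and f_i f_j = f_j f_i for |i−j| ≠ 1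
    (hee : ∀ i j, 1 ≤ i → i ≤ n + m → 1 ≤ j → j ≤ n + m → i ≠ j + 1 → j ≠ i + 1 →
      e i * e j = e j * e i)
    (hff : ∀ i j, 1 ≤ i → i ≤ n + m → 1 ≤ j → j ≤ n + m → i ≠ j + 1 → j ≠ i + 1 →
      f i * f j = f j * f i)
    -- e_{n+1}² = f_{n+1}² = 0
    (hesq : n + 1 ≤ n + m → e (n + 1) * e (n + 1) = 0)
    (hfsq : n + 1 ≤ n + m → f (n + 1) * f (n + 1) = 0)
    -- triple Serre relations
    (heSerre : ∀ i j, 1 ≤ i → i ≤ n + m → 1 ≤ j → j ≤ n + m → i ≠ n + 1 →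
      (j = i + 1 ∨ i = j + 1) →
      cmx q (e i) (cmx q⁻¹ (e i) (e j)) = 0 ∧ cmx q⁻¹ (e i) (cmx q (e i) (e j)) = 0)
    (hfSerre : ∀ i j, 1 ≤ i → i ≤ n + m → 1 ≤ j → j ≤ n + m → i ≠ n + 1 →
      (j = i + 1 ∨ i = j + 1) →
      cmx q (f i) (cmx q⁻¹ (f i) (f j)) = 0 ∧ cmx q⁻¹ (f i) (cmx q (f i) (f j)) = 0)
    -- additional Serre relations
    (heAdd : 1 ≤ n → n + 2 ≤ n + m →
      e (n + 1) * cmx q⁻¹ (cmx q (e n) (e (n + 1))) (e (n + 2))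
          + cmx q⁻¹ (cmx q (e n) (e (n + 1))) (e (n + 2)) * e (n + 1) = 0 ∧
      e (n + 1) * cmx q (cmx q⁻¹ (e n) (e (n + 1))) (e (n + 2))
          + cmx q (cmx q⁻¹ (e n) (e (n + 1))) (e (n + 2)) * e (n + 1) = 0)
    (hfAdd : 1 ≤ n → n + 2 ≤ n + m →
      f (n + 1) * cmx q⁻¹ (cmx q (f n) (f (n + 1))) (f (n + 2))
          + cmx q⁻¹ (cmx q (f n) (f (n + 1))) (f (n + 2)) * f (n + 1) = 0 ∧
      f (n + 1) * cmx q (cmx q⁻¹ (f n) (f (n + 1))) (f (n + 2))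
          + cmx q (cmx q⁻¹ (f n) (f (n + 1))) (f (n + 2)) * f (n + 1) = 0)
    -- the deformed creation and annihilation generators
    (aP aM : ℕ → A)
    (haM1 : aM 1 = e 1) (haP1 : aP 1 = f 1)
    (haM : ∀ i, 2 ≤ i → i ≤ n + m →
      aM i = aM (i - 1) * e i - (qc (i - 1))⁻¹ • (e i * aM (i - 1)))
    (haP : ∀ i, 2 ≤ i → i ≤ n + m →
      aP i = f i * aP (i - 1) - qc (i - 1) • (aP (i - 1) * f i))
    -- L_i = ∏_{p=1}^{i} k_p^{(−1)^{θ_{p−1}}} and its inverse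
    (L Lb : ℕ → A)
    (hL1 : L 1 = k 1) (hLb1 : Lb 1 = kb 1)
    (hL : ∀ i, 2 ≤ i → i ≤ n + m →
      L i = L (i - 1) * (if thetaIdx n (i - 1) = 0 then k i else kb i))
    (hLb : ∀ i, 2 ≤ i → i ≤ n + m →
      Lb i = Lb (i - 1) * (if thetaIdx n (i - 1) = 0 then kb i else k i))
    :
    (∀ i : ℕ, 1 ≤ i → i ≤ n + m →
      aM i * aP i - ((-1 : K) ^ thetaIdx n i) • (aP i * aM i)
        = (q - q⁻¹)⁻¹ • (L i - Lb i)) ∧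
    (∀ i : ℕ, 1 ≤ i → i + 1 ≤ n + m →
      (aM i * aP (i + 1)
          - ((-1 : K) ^ (thetaIdx n i * thetaIdx n (i + 1))) • (aP (i + 1) * aM i)
        = -(((-1 : K) ^ thetaIdx n i) • (L i * f (i + 1)))) ∧
      (aM (i + 1) * aP i
          - ((-1 : K) ^ (thetaIdx n i * thetaIdx n (i + 1))) • (aP i * aM (i + 1))
        = -(((-1 : K) ^ thetaIdx n i) • (e (i + 1) * Lb i)))) := by
  have hqq : q - q⁻¹ ≠ 0 := by
    intro h
    apply hq1
    field_simp at h
    linear_combination h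
  -- elementary commutation relations
  have hef' : ∀ i j, 1 ≤ i → i ≤ n + m → 1 ≤ j → j ≤ n + m → i ≠ j → e i * f j = f j * e i := by
    intro i j h1 h2 h3 h4 h5
    have := hef i j h1 h2 h3 h4
    rw [if_neg h5, zero_smul, (pIdx_even h5).neg_one_pow, one_smul, sub_eq_zero] at this
    exact this
  have hefd : ∀ i, 1 ≤ i → i ≤ n + m →
      e i * f i - ((-1 : K) ^ pIdx n i) • (f i * e i) = (q - q⁻¹)⁻¹ • (k i - kb i) := by
    intro i h1 h2
    have := hef i i h1 h2 h1 h2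
    rw [if_pos rfl] at this
    rw [← this]
    congr 2
    rcases lt_trichotomy i (n + 1) with hi | hi | hi
    · rw [pIdx_le (by omega)]
    · subst hi; rw [pIdx_eq]
    · rw [pIdx_gt hi]; norm_num
  have ke : ∀ i j, 1 ≤ i → i ≤ n + m → 1 ≤ j → j ≤ n + m →
      QCom (q ^ alphaMat n i j) (k i) (e j) := hke
  have kf : ∀ i j, 1 ≤ i → i ≤ n + m → 1 ≤ j → j ≤ n + m →
      QCom (q ^ (-alphaMat n i j)) (k i) (f j) := hkf
  have kbe : ∀ i j, 1 ≤ i → i ≤ n + m → 1 ≤ j → j ≤ n + m →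
      QCom (q ^ alphaMat n i j)⁻¹ (kb i) (e j) := fun i j h1 h2 h3 h4 =>
    (ke i j h1 h2 h3 h4).inv_left (zpow_ne_zero _ hq0) (hkinv i h1 h2).1 (hkinv i h1 h2).2
  have kbf : ∀ i j, 1 ≤ i → i ≤ n + m → 1 ≤ j → j ≤ n + m →
      QCom (q ^ (-alphaMat n i j))⁻¹ (kb i) (f j) := fun i j h1 h2 h3 h4 =>
    (kf i j h1 h2 h3 h4).inv_left (zpow_ne_zero _ hq0) (hkinv i h1 h2).1 (hkinv i h1 h2).2
  have haM' : ∀ i, 1 ≤ i → i + 1 ≤ n + m →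
      aM (i + 1) = aM i * e (i + 1) - (qc i)⁻¹ • (e (i + 1) * aM i) := by
    intro i h1 h2
    simpa using haM (i + 1) (by omega) h2
  have haP' : ∀ i, 1 ≤ i → i + 1 ≤ n + m →
      aP (i + 1) = f (i + 1) * aP i - qc i • (aP i * f (i + 1)) := by
    intro i h1 h2
    simpa using haP (i + 1) (by omega) h2
  have hL' : ∀ i, 1 ≤ i → i + 1 ≤ n + m →
      L (i + 1) = L i * (if thetaIdx n i = 0 then k (i + 1) else kb (i + 1)) := by
    intro i h1 h2
    simpa using hL (i + 1) (by omega) h2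
  have hLb' : ∀ i, 1 ≤ i → i + 1 ≤ n + m →
      Lb (i + 1) = Lb i * (if thetaIdx n i = 0 then kb (i + 1) else k (i + 1)) := by
    intro i h1 h2
    simpa using hLb (i + 1) (by omega) h2
  -- a_i^- commutes with f_j and a_i^+ commutes with e_j for j > i
  have hMf : ∀ i, 1 ≤ i → i ≤ n + m → ∀ j, i < j → j ≤ n + m → QCom (1 : K) (aM i) (f j) := by
    intro i hi
    induction i, hi using Nat.le_induction with
    | base =>
      intro h j h1 h2
      simpa [QCom, haM1] using hef' 1 j le_rfl h (by omega) h2 (by omega)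
    | succ i hi ih =>
      intro h j h1 h2
      rw [haM' i hi h, ← one_mul (1 : K)]
      refine (ih (by omega) j (by omega) h2).braid_comm ?_
      simpa [QCom] using hef' (i + 1) j (by omega) h (by omega) h2 (by omega)
  have hPe : ∀ i, 1 ≤ i → i ≤ n + m → ∀ j, i < j → j ≤ n + m → QCom (1 : K) (e j) (aP i) := by
    intro i hi
    induction i, hi using Nat.le_induction with
    | base =>
      intro h j h1 h2
      simpa [QCom, haP1] using hef' j 1 (by omega) h2 le_rfl h (by omega)
    | succ i hi ih =>
      intro h j h1 h2
      rw [haP' i hi h, ← one_mul (1 : K)]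
      refine QCom.comm_braid ?_ (ih (by omega) j (by omega) h2)
      simpa [QCom] using hef' j (i + 1) (by omega) h2 (by omega) h (by omega)
  -- k_j against a_i^±
  have hkMfar : ∀ i, 1 ≤ i → i ≤ n + m → ∀ j, i + 2 ≤ j → j ≤ n + m →
      QCom (1 : K) (k j) (aM i) := by
    intro i hi
    induction i, hi using Nat.le_induction with
    | base =>
      intro h j h1 h2
      simpa [haM1, alphaMat_far (n := n) (Or.inr h1)] using ke j 1 (by omega) h2 le_rfl h
    | succ i hi ih =>
      intro h j h1 h2
      rw [haM' i hi h, ← one_mul (1 : K)]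
      refine QCom.comm_braid (ih (by omega) j (by omega) h2) ?_
      simpa [alphaMat_far (n := n) (Or.inr h1)] using ke j (i + 1) (by omega) h2 (by omega) h
  have hkPfar : ∀ i, 1 ≤ i → i ≤ n + m → ∀ j, i + 2 ≤ j → j ≤ n + m →
      QCom (1 : K) (k j) (aP i) := by
    intro i hi
    induction i, hi using Nat.le_induction with
    | base =>
      intro h j h1 h2
      simpa [haP1, alphaMat_far (n := n) (Or.inr h1)] using kf j 1 (by omega) h2 le_rfl h
    | succ i hi ih =>
      intro h j h1 h2
      rw [haP' i hi h, ← one_mul (1 : K)]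
      refine QCom.comm_braid ?_ (ih (by omega) j (by omega) h2)
      simpa [alphaMat_far (n := n) (Or.inr h1)] using kf j (i + 1) (by omega) h2 (by omega) h
  have hkM : ∀ i, 1 ≤ i → i + 1 ≤ n + m → QCom q⁻¹ (k (i + 1)) (aM i) := by
    intro i hi h
    have h0 := ke (i + 1) i (by omega) h hi (by omega)
    rw [alphaMat_down, zpow_neg_one] at h0
    obtain rfl | ⟨i, rfl⟩ : i = 1 ∨ ∃ t, i = t + 1 := by right; exact ⟨i - 1, by omega⟩
    · rwa [haM1]
    · rcases Nat.eq_zero_or_pos i with rfl | hi'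
      · simpa [haM1] using h0
      · rw [haM' i hi' (by omega), ← one_mul q⁻¹]
        exact (hkMfar i hi' (by omega) _ le_rfl h).comm_braid h0
  have hkP : ∀ i, 1 ≤ i → i + 1 ≤ n + m → QCom q (k (i + 1)) (aP i) := by
    intro i hi h
    have h0 := kf (i + 1) i (by omega) h hi (by omega)
    rw [alphaMat_down, neg_neg, zpow_one] at h0
    obtain ⟨i, rfl⟩ : ∃ t, i = t + 1 := ⟨i - 1, by omega⟩
    rcases Nat.eq_zero_or_pos i with rfl | hi'
    · simpa [haP1] using h0
    · rw [haP' i hi' (by omega), ← mul_one q]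
      exact h0.comm_braid (hkPfar i hi' (by omega) _ le_rfl h)
  have hkbM : ∀ i, 1 ≤ i → i + 1 ≤ n + m → QCom q (kb (i + 1)) (aM i) := by
    intro i hi h
    have := (hkM i hi h).inv_left (inv_ne_zero hq0) (hkinv (i + 1) (by omega) h).1
      (hkinv (i + 1) (by omega) h).2
    rwa [inv_inv] at this
  have hkbP : ∀ i, 1 ≤ i → i + 1 ≤ n + m → QCom q⁻¹ (kb (i + 1)) (aP i) := by
    intro i hi h
    exact (hkP i hi h).inv_left hq0 (hkinv (i + 1) (by omega) h).1
      (hkinv (i + 1) (by omega) h).2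
  -- L_i against e_j, f_j
  have hLfar : ∀ i, 1 ≤ i → i ≤ n + m → ∀ j, i + 2 ≤ j → j ≤ n + m →
      QCom (1 : K) (L i) (e j) ∧ QCom (1 : K) (L i) (f j) ∧
      QCom (1 : K) (Lb i) (e j) ∧ QCom (1 : K) (Lb i) (f j) := by
    intro i hi
    induction i, hi using Nat.le_induction with
    | base =>
      intro h j h1 h2
      have a1 := ke 1 j le_rfl h (by omega) h2
      have a2 := kf 1 j le_rfl h (by omega) h2
      have a3 := kbe 1 j le_rfl h (by omega) h2
      have a4 := kbf 1 j le_rfl h (by omega) h2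
      simp only [alphaMat_far (n := n) (Or.inl h1), neg_zero, zpow_zero, inv_one] at a1 a2 a3 a4
      rw [hL1, hLb1]
      exact ⟨a1, a2, a3, a4⟩
    | succ i hi ih =>
      intro h j h1 h2
      have a1 := ke (i + 1) j (by omega) h (by omega) h2
      have a2 := kf (i + 1) j (by omega) h (by omega) h2
      have a3 := kbe (i + 1) j (by omega) h (by omega) h2
      have a4 := kbf (i + 1) j (by omega) h (by omega) h2
      simp only [alphaMat_far (n := n) (Or.inl h1), neg_zero, zpow_zero, inv_one] at a1 a2 a3 a4
      obtain ⟨b1, b2, b3, b4⟩ := ih (by omega) j (by omega) h2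
      rw [hL' i hi h, hLb' i hi h, ← one_mul (1 : K)]
      split_ifs
      · exact ⟨b1.mul_left a1, b2.mul_left a2, b3.mul_left a3, b4.mul_left a4⟩
      · exact ⟨b1.mul_left a3, b2.mul_left a4, b3.mul_left a1, b4.mul_left a2⟩
  have hLnear : ∀ i, 1 ≤ i → i + 1 ≤ n + m →
      QCom (qc i)⁻¹ (L i) (e (i + 1)) ∧ QCom (qc i) (L i) (f (i + 1)) ∧
      QCom (qc i) (Lb i) (e (i + 1)) ∧ QCom (qc i)⁻¹ (Lb i) (f (i + 1)) := by
    intro i hi h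
    have a1 := ke i (i + 1) hi (by omega) (by omega) h
    have a2 := kf i (i + 1) hi (by omega) (by omega) h
    have a3 := kbe i (i + 1) hi (by omega) (by omega) h
    have a4 := kbf i (i + 1) hi (by omega) (by omega) h
    rw [alphaMat_up] at a1 a2 a3 a4
    rw [hqc]
    obtain ⟨i, rfl⟩ : ∃ t, i = t + 1 := ⟨i - 1, by omega⟩
    rcases Nat.eq_zero_or_pos i with rfl | hi'
    · rw [zero_add] at *
      rw [hL1, hLb1]
      rcases Nat.eq_zero_or_pos n with rfl | hn
      · rw [pIdx_eq (n := 0)] at a1 a2 a3 a4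
        simp at a1 a2 a3 a4 ⊢
        exact ⟨a1, a2, a3, a4⟩
      · rw [pIdx_le hn] at a1 a2 a3 a4
        simp [Nat.succ_le_of_lt hn] at a1 a2 a3 a4 ⊢
        exact ⟨a1, a2, a3, a4⟩
    · obtain ⟨b1, b2, b3, b4⟩ := hLfar i hi' (by omega) (i + 1 + 1) le_rfl h
      rw [hL' i hi' (by omega), hLb' i hi' (by omega)]
      rcases lt_trichotomy (i + 1) (n + 1) with hn | hn | hn
      · rw [pIdx_le (by omega)] at a1 a2 a3 a4
        rw [thetaIdx_le (show i ≤ n by omega), if_pos rfl, if_pos rfl, if_pos (by omega)]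
        have c1 := b1.mul_left a1
        have c2 := b2.mul_left a2
        have c3 := b3.mul_left a3
        have c4 := b4.mul_left a4
        simp at c1 c2 c3 c4
        exact ⟨c1, c2, c3, c4⟩
      · rw [hn, pIdx_eq] at a1 a2 a3 a4
        rw [thetaIdx_le (show i ≤ n by omega), if_pos rfl, if_pos rfl, if_neg (by omega), hn]
        rw [hn] at b1 b2 b3 b4
        have c1 := b1.mul_left a1
        have c2 := b2.mul_left a2
        have c3 := b3.mul_left a3
        have c4 := b4.mul_left a4
        simp at c1 c2 c3 c4 ⊢
        exact ⟨c1, c2, c3, c4⟩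
      · rw [pIdx_gt hn] at a1 a2 a3 a4
        rw [thetaIdx_gt (show n < i by omega), if_neg one_ne_zero, if_neg one_ne_zero, if_neg (by omega)]
        have c1 := b1.mul_left a3
        have c2 := b2.mul_left a4
        have c3 := b3.mul_left a1
        have c4 := b4.mul_left a2
        simp at c1 c2 c3 c4 ⊢
        exact ⟨c1, c2, c3, c4⟩
  have hQ0 : ∀ i, qc i ≠ 0 := by
    intro i
    rw [hqc]
    split_ifs
    · exact hq0
    · exact inv_ne_zero hq0
  have hcs : ∀ i, (q - q⁻¹)⁻¹ * ((qc i)⁻¹ - qc i) = -(-1 : K) ^ thetaIdx n i := by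
    intro i
    rw [hqc, inv_mul_eq_iff_eq_mul₀ hqq]
    by_cases h : i ≤ n
    · rw [if_pos h, thetaIdx_le h]; ring
    · rw [if_neg h, thetaIdx_gt (by omega), inv_inv]; ring
  have hth : ∀ i, thetaIdx n i * thetaIdx n (i + 1) = thetaIdx n i := by
    intro i
    by_cases h : i ≤ n
    · rw [thetaIdx_le h, zero_mul]
    · rw [thetaIdx_gt (i := i + 1) (by omega), mul_one]
  -- second relation from the first
  have R2 : ∀ i, 1 ≤ i → i + 1 ≤ n + m →
      aM i * aP i - ((-1 : K) ^ thetaIdx n i) • (aP i * aM i) = (q - q⁻¹)⁻¹ • (L i - Lb i) →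
      aM i * (f (i + 1) * aP i - qc i • (aP i * f (i + 1)))
          - ((-1 : K) ^ thetaIdx n i) • ((f (i + 1) * aP i - qc i • (aP i * f (i + 1))) * aM i)
        = -(((-1 : K) ^ thetaIdx n i) • (L i * f (i + 1))) := by
    intro i hi h h1
    obtain ⟨b1, b2, b3, b4⟩ := hLnear i hi h
    refine step_two (qc i) _ _ (hcs i) (hQ0 i) _ _ _ _ _ h1 ?_ b2 b4
    simpa [QCom] using hMf i hi (by omega) (i + 1) (by omega) h
  have hPe' : ∀ i, 1 ≤ i → i + 1 ≤ n + m → e (i + 1) * aP i = aP i * e (i + 1) := by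
    intro i hi h
    simpa [QCom] using hPe i hi (by omega) (i + 1) (by omega) h
  -- the first relation
  have R1 : ∀ i : ℕ, 1 ≤ i → i ≤ n + m →
      aM i * aP i - ((-1 : K) ^ thetaIdx n i) • (aP i * aM i)
        = (q - q⁻¹)⁻¹ • (L i - Lb i) := by
    intro i hi
    induction i, hi using Nat.le_induction with
    | base =>
      intro h
      have := hefd 1 le_rfl h
      rw [haM1, haP1, hL1, hLb1, ← this]
      simp [pIdx, thetaIdx]
    | succ i hi ih =>
      intro h
      have h1 := ih (by omega)
      obtain ⟨b1, b2, b3, b4⟩ := hLnear i hi h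
      have hkaps : ∃ kap : A, kap = (if thetaIdx n i = 0 then kb (i + 1) else k (i + 1)) ∧
          (q - q⁻¹)⁻¹ • ((k (i + 1) - kb (i + 1)) * aP i)
            - ((q - q⁻¹)⁻¹ * qc i) • (aP i * (k (i + 1) - kb (i + 1))) = aP i * kap ∧
          QCom (qc i) kap (aM i) := by
        refine ⟨_, rfl, ?_, ?_⟩
        · have c1 := hkP i hi h
          have c2 := hkbP i hi h
          have hd : (q - q⁻¹)⁻¹ * (q - q⁻¹) = 1 := inv_mul_cancel₀ hqq
          unfold QCom at c1 c2
          rw [sub_mul, c1, c2, mul_sub, hqc]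
          by_cases hn : i ≤ n
          · rw [if_pos hn, thetaIdx_le hn, if_pos rfl]
            match_scalars
            · ring
            · linear_combination hd
          · rw [if_neg hn, thetaIdx_gt (show n < i by omega), if_neg one_ne_zero]
            match_scalars
            · linear_combination hd
            · ring
        · rw [hqc]
          by_cases hn : i ≤ n
          · rw [if_pos hn, thetaIdx_le hn, if_pos rfl]
            exact hkbM i hi h
          · rw [if_neg hn, thetaIdx_gt (show n < i by omega), if_neg one_ne_zero]
            exact hkM i hi h
      obtain ⟨kap, hkap, hk1, hk2⟩ := hkaps
      have key := step_one (qc i) _ _ _ (hQ0 i) _ _ _ _ _ _ _ _ kap h1 (R2 i hi h h1)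
        (hPe' i hi h) b1 (hefd (i + 1) (by omega) h) hk1 hk2
      have hsgn : (-1 : K) ^ pIdx n (i + 1) * (-1) ^ thetaIdx n i
          = (-1) ^ thetaIdx n (i + 1) := by
        rw [← pow_add]
        simp only [pIdx, Nat.add_sub_cancel]
        rw [show thetaIdx n i + thetaIdx n (i + 1) + thetaIdx n i
          = thetaIdx n (i + 1) + 2 * thetaIdx n i by ring, pow_add, pow_mul]
        simp
      rw [haM' i hi h, haP' i hi h, ← hsgn, key, hL' i hi h, hLb' i hi h, hkap]
      by_cases hn : i ≤ n
      · simp only [thetaIdx_le hn, if_true, mul_sub, sub_mul, pow_zero]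
        module
      · simp only [thetaIdx_gt (show n < i by omega), one_ne_zero, if_false, mul_sub, sub_mul,
          pow_one]
        module
  refine ⟨R1, ?_⟩
  intro i hi h
  rw [hth, haM' i hi h, haP' i hi h]
  refine ⟨R2 i hi h (R1 i hi (by omega)), ?_⟩
  obtain ⟨b1, b2, b3, b4⟩ := hLnear i hi h
  exact step_three (qc i) _ _ (hcs i) (hQ0 i) _ _ _ _ _ (R1 i hi (by omega)) (hPe' i hi h) b1 b3
end

section
/- (Proposition 3: the deformed creation and annihilation generators generate the algebra.) For all 1 ≤ i ≤ N−1: e_{i+1} = −(−1)^{θ_i}·(a_{i+1}^-·a_i^+ − (−1)^{θ_iθ_{i+1}}·a_i^+·a_{i+1}^-)·L_i and f_{i+1} = −(−1)^{θ_i}·L̄_i·(a_i^-·a_{i+1}^+ − (−1)^{θ_iθ_{i+1}}·a_{i+1}^+·a_i^-). Consequently the K-subalgebra of A generated by {a_i^+, a_i^-, L_i, L̄_i : 1 ≤ i ≤ N} contains every e_i, f_i, k_i and k̄_i. -/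
section helpers
variable {K A : Type*} [Field K] [Ring A] [Algebra K A]

/-- `x` and `y` commute up to the scalar `c`. -/
def SC (c : K) (x y : A) : Prop := x * y = c • (y * x)

theorem SC.mul_rightSC {c d : K} {x y z : A} (h : SC c x y) (hh : SC d x z) :
    SC (c * d) x (y * z) := by
  unfold SC at *
  rw [← mul_assoc, h, smul_mul_assoc, mul_assoc, hh, mul_smul_comm, smul_smul, mul_assoc]

theorem SC.mul_leftSC {c d : K} {x w y : A} (h : SC c x y) (hh : SC d w y) :
    SC (c * d) (x * w) y := by
  unfold SC at *
  rw [mul_assoc, hh, mul_smul_comm, ← mul_assoc, h, smul_mul_assoc, smul_smul, mul_assoc,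
    mul_comm d c]

theorem SC.comb {c d : K} {x y z : A} (h : SC c x y) (hh : SC c x z) :
    SC c x (y - d • z) := by
  unfold SC at *
  rw [mul_sub, sub_mul, mul_smul_comm, smul_mul_assoc, h, hh, smul_sub, smul_comm]

theorem SC.invSC {c : K} (hc : c ≠ 0) {x xb y : A} (h1 : x * xb = 1) (h2 : xb * x = 1)
    (h : SC c x y) : SC c⁻¹ xb y := by
  unfold SC at *
  have : xb * y = xb * (c⁻¹ • (c • (y * x))) * xb := by
    rw [smul_smul, inv_mul_cancel₀ hc, one_smul, mul_assoc, mul_assoc, h1, mul_one]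
  rw [this, ← h, mul_smul_comm, ← mul_assoc, h2, one_mul, smul_mul_assoc]

theorem SC.of_eq {x y : A} (h : x * y = y * x) : SC (1 : K) x y := by
  unfold SC; rw [one_smul, h]

theorem SC.eq {x y : A} (h : SC (1 : K) x y) : x * y = y * x := by
  unfold SC at h; rwa [one_smul] at h

/-- The bracket `[a_{i+1}^-, a_i^+]`. -/
theorem stepB {Q s c σ : K} (hc : c * (Q - Q⁻¹) = σ)
    {x a e L Lb : A} (hea : e * a = a * e)
    (hLe : SC Q⁻¹ L e) (hLbe : SC Q Lb e)
    (hC : x * a - s • (a * x) = c • (L - Lb)) :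
    (x * e - Q⁻¹ • (e * x)) * a - s • (a * (x * e - Q⁻¹ • (e * x))) = -(σ • (e * Lb)) := by
  unfold SC at *
  have h1 : (x * e - Q⁻¹ • (e * x)) * a - s • (a * (x * e - Q⁻¹ • (e * x)))
      = (x * a - s • (a * x)) * e - Q⁻¹ • (e * (x * a - s • (a * x))) := by
    simp only [sub_mul, mul_sub, smul_mul_assoc, mul_smul_comm, mul_assoc, hea]
    simp only [← mul_assoc, hea]
    module
  rw [h1, hC]
  simp only [sub_mul, mul_sub, smul_mul_assoc, mul_smul_comm, hLe, hLbe, ← hc]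
  match_scalars <;> ring

/-- The bracket `[a_i^-, a_{i+1}^+]`. -/
theorem stepD {Q s c σ : K} (hQ : Q ≠ 0) (hc : c * (Q - Q⁻¹) = σ)
    {x a f L Lb : A} (hfx : f * x = x * f)
    (hLf : SC Q L f) (hLbf : SC Q⁻¹ Lb f)
    (hC : x * a - s • (a * x) = c • (L - Lb)) :
    x * (f * a - Q • (a * f)) - s • ((f * a - Q • (a * f)) * x) = -(σ • (L * f)) := by
  unfold SC at *
  have h1 : x * (f * a - Q • (a * f)) - s • ((f * a - Q • (a * f)) * x)
      = f * (x * a - s • (a * x)) - Q • ((x * a - s • (a * x)) * f) := by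
    simp only [sub_mul, mul_sub, smul_mul_assoc, mul_smul_comm, mul_assoc, hfx]
    simp only [← mul_assoc, hfx]
    module
  rw [h1, hC]
  simp only [sub_mul, mul_sub, smul_mul_assoc, mul_smul_comm, hLf, hLbf, ← hc]
  match_scalars <;> field_simp <;> ring

/-- The bracket `[a_{i+1}^-, f_{i+1}]`. -/
theorem stepF {Q t C : K} (hQ : Q ≠ 0) (hC1 : C * (Q - Q⁻¹) = 1)
    {x e f κ κb : A} (hfx : f * x = x * f)
    (hκx : SC Q⁻¹ κ x) (hκbx : SC Q κb x)
    (hef : e * f - t • (f * e) = C • (κ - κb)) :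
    (x * e - Q⁻¹ • (e * x)) * f - t • (f * (x * e - Q⁻¹ • (e * x))) = κ * x := by
  unfold SC at *
  have h1 : (x * e - Q⁻¹ • (e * x)) * f - t • (f * (x * e - Q⁻¹ • (e * x)))
      = x * (e * f - t • (f * e)) - Q⁻¹ • ((e * f - t • (f * e)) * x) := by
    simp only [sub_mul, mul_sub, smul_mul_assoc, mul_smul_comm, mul_assoc, hfx]
    simp only [← mul_assoc, hfx]
    module
  rw [h1, hef]
  simp only [sub_mul, mul_sub, smul_mul_assoc, mul_smul_comm, hκx, hκbx]
  have : Q⁻¹ = C * (Q - Q⁻¹) * Q⁻¹ := by rw [hC1, one_mul]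
  match_scalars
  · linear_combination (norm := skip) (Q⁻¹) * hC1
    field_simp; ring
  · field_simp; ring

/-- The induction step for `[a_i^-, a_i^+] = (L_i - L̄_i)/(q - q̄)`. -/
theorem stepC {Q s t c σ C : K} (hQ : Q ≠ 0) (hc : c * (Q - Q⁻¹) = σ)
    (hC1 : C * (Q - Q⁻¹) = 1)
    {x a e f κ κb L Lb : A} (hea : e * a = a * e) (hfx : f * x = x * f)
    (hLe : SC Q⁻¹ L e) (hLbe : SC Q Lb e) (hLbf : SC Q⁻¹ Lb f)
    (hκx : SC Q⁻¹ κ x) (hκbx : SC Q κb x) (hκa : SC Q κ a)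
    (hef : e * f - t • (f * e) = C • (κ - κb))
    (hκL : κ * L = L * κ) (hκbLb : κb * Lb = Lb * κb)
    (hC : x * a - s • (a * x) = c • (L - Lb)) :
    (x * e - Q⁻¹ • (e * x)) * (f * a - Q • (a * f))
      - (s * t) • ((f * a - Q • (a * f)) * (x * e - Q⁻¹ • (e * x)))
      = c • (L * κ - Lb * κb) := by
  have hB := stepB hc hea hLe hLbe hC
  have hF := stepF hQ hC1 hfx hκx hκbx hef
  generalize x * e - Q⁻¹ • (e * x) = b at *
  unfold SC at *
  have h1 : b * (f * a - Q • (a * f)) - (s * t) • ((f * a - Q • (a * f)) * b)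
      = (b * f - t • (f * b)) * a + t • (f * (b * a - s • (a * b)))
        - Q • ((b * a - s • (a * b)) * f) - (Q * s) • (a * (b * f - t • (f * b))) := by
    simp only [sub_mul, mul_sub, smul_mul_assoc, mul_smul_comm, mul_assoc]
    module
  have h2 : c • (κ * (L - Lb)) = κ * x * a - (Q * s) • (a * (κ * x)) := by
    rw [← mul_smul_comm, ← hC, mul_sub, mul_smul_comm, ← mul_assoc κ a x, hκa, smul_mul_assoc,
      smul_smul, mul_assoc, mul_assoc, mul_comm Q s]
  have h3 : c = σ * C := by linear_combination C * hc - c * hC1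
  have h4 : t • (f * e * Lb) - e * f * Lb = -(C • ((κ - κb) * Lb)) := by
    rw [← smul_mul_assoc C, ← hef, sub_mul, smul_mul_assoc]; abel
  have h5 : e * Lb * f = Q⁻¹ • (e * f * Lb) := by
    rw [mul_assoc, hLbf, mul_smul_comm, mul_assoc]
  have h6 : t • (f * -(σ • (e * Lb))) - Q • (-(σ • (e * Lb)) * f)
      = c • ((κ - κb) * Lb) := by
    rw [h3, mul_smul, ← neg_eq_iff_eq_neg.mpr h4]
    simp only [mul_neg, neg_mul, mul_smul_comm, smul_mul_assoc, h5, ← mul_assoc]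
    match_scalars <;> field_simp
  rw [h1, hB, hF, ← hκL, ← hκbLb]
  calc _ = (κ * x * a - (Q * s) • (a * (κ * x))) +
      (t • (f * -(σ • (e * Lb))) - Q • (-(σ • (e * Lb)) * f)) := by abel
    _ = _ := by
      rw [← h2, h6]; simp only [mul_sub, sub_mul]; module
end helpers

set_option maxHeartbeats 2000000 in
/-- Proposition 3: the deformed creation and annihilation generators generate
the algebra. -/
theorem stmt13
    (K : Type*) (A : Type*) [Field K] [Ring A] [Algebra K A]
    (n m : ℕ) (hm : 1 ≤ m)
    (q : K) (hq0 : q ≠ 0) (hq1 : q ^ 2 ≠ 1)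
    (qc : ℕ → K) (hqc : ∀ i, qc i = if i ≤ n then q else q⁻¹)
    (e f k kb : ℕ → A)
    -- k_i k̄_i = k̄_i k_i = 1
    (hkinv : ∀ i, 1 ≤ i → i ≤ n + m → k i * kb i = 1 ∧ kb i * k i = 1)
    -- k_i k_j = k_j k_i
    (hkk : ∀ i j, 1 ≤ i → i ≤ n + m → 1 ≤ j → j ≤ n + m → k i * k j = k j * k i)
    -- k_i e_j = q^{α_{ij}} e_j k_i
    (hke : ∀ i j, 1 ≤ i → i ≤ n + m → 1 ≤ j → j ≤ n + m →
      k i * e j = (q ^ alphaMat n i j) • (e j * k i))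
    -- k_i f_j = q^{−α_{ij}} f_j k_i
    (hkf : ∀ i j, 1 ≤ i → i ≤ n + m → 1 ≤ j → j ≤ n + m →
      k i * f j = (q ^ (-alphaMat n i j)) • (f j * k i))
    -- e_i f_j − (−1)^{p_i p_j} f_j e_i = δ_{ij}(q−q̄)⁻¹(k_i−k̄_i)
    (hef : ∀ i j, 1 ≤ i → i ≤ n + m → 1 ≤ j → j ≤ n + m →
      e i * f j - ((-1 : K) ^ (pIdx n i * pIdx n j)) • (f j * e i)
        = (if i = j then (q - q⁻¹)⁻¹ else 0) • (k i - kb i))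
    -- e_i e_j = e_j e_i and f_i f_j = f_j f_i for |i−j| ≠ 1
    (hee : ∀ i j, 1 ≤ i → i ≤ n + m → 1 ≤ j → j ≤ n + m → i ≠ j + 1 → j ≠ i + 1 →
      e i * e j = e j * e i)
    (hff : ∀ i j, 1 ≤ i → i ≤ n + m → 1 ≤ j → j ≤ n + m → i ≠ j + 1 → j ≠ i + 1 →
      f i * f j = f j * f i)
    -- e_{n+1}² = f_{n+1}² = 0
    (hesq : n + 1 ≤ n + m → e (n + 1) * e (n + 1) = 0)
    (hfsq : n + 1 ≤ n + m → f (n + 1) * f (n + 1) = 0)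
    -- triple Serre relations
    (heSerre : ∀ i j, 1 ≤ i → i ≤ n + m → 1 ≤ j → j ≤ n + m → i ≠ n + 1 →
      (j = i + 1 ∨ i = j + 1) →
      cmx q (e i) (cmx q⁻¹ (e i) (e j)) = 0 ∧ cmx q⁻¹ (e i) (cmx q (e i) (e j)) = 0)
    (hfSerre : ∀ i j, 1 ≤ i → i ≤ n + m → 1 ≤ j → j ≤ n + m → i ≠ n + 1 →
      (j = i + 1 ∨ i = j + 1) →
      cmx q (f i) (cmx q⁻¹ (f i) (f j)) = 0 ∧ cmx q⁻¹ (f i) (cmx q (f i) (f j)) = 0)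
    -- additional Serre relations
    (heAdd : 1 ≤ n → n + 2 ≤ n + m →
      e (n + 1) * cmx q⁻¹ (cmx q (e n) (e (n + 1))) (e (n + 2))
          + cmx q⁻¹ (cmx q (e n) (e (n + 1))) (e (n + 2)) * e (n + 1) = 0 ∧
      e (n + 1) * cmx q (cmx q⁻¹ (e n) (e (n + 1))) (e (n + 2))
          + cmx q (cmx q⁻¹ (e n) (e (n + 1))) (e (n + 2)) * e (n + 1) = 0)
    (hfAdd : 1 ≤ n → n + 2 ≤ n + m →
      f (n + 1) * cmx q⁻¹ (cmx q (f n) (f (n + 1))) (f (n + 2))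
          + cmx q⁻¹ (cmx q (f n) (f (n + 1))) (f (n + 2)) * f (n + 1) = 0 ∧
      f (n + 1) * cmx q (cmx q⁻¹ (f n) (f (n + 1))) (f (n + 2))
          + cmx q (cmx q⁻¹ (f n) (f (n + 1))) (f (n + 2)) * f (n + 1) = 0)
    -- the deformed creation and annihilation generators
    (aP aM : ℕ → A)
    (haM1 : aM 1 = e 1) (haP1 : aP 1 = f 1)
    (haM : ∀ i, 2 ≤ i → i ≤ n + m →
      aM i = aM (i - 1) * e i - (qc (i - 1))⁻¹ • (e i * aM (i - 1)))
    (haP : ∀ i, 2 ≤ i → i ≤ n + m →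
      aP i = f i * aP (i - 1) - qc (i - 1) • (aP (i - 1) * f i))
    -- L_i = ∏_{p=1}^{i} k_p^{(−1)^{θ_{p−1}}} and its inverse
    (L Lb : ℕ → A)
    (hL1 : L 1 = k 1) (hLb1 : Lb 1 = kb 1)
    (hL : ∀ i, 2 ≤ i → i ≤ n + m →
      L i = L (i - 1) * (if thetaIdx n (i - 1) = 0 then k i else kb i))
    (hLb : ∀ i, 2 ≤ i → i ≤ n + m →
      Lb i = Lb (i - 1) * (if thetaIdx n (i - 1) = 0 then kb i else k i))
    :
    (∀ i : ℕ, 1 ≤ i → i + 1 ≤ n + m →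
      e (i + 1) = -(((-1 : K) ^ thetaIdx n i) •
          ((aM (i + 1) * aP i
              - ((-1 : K) ^ (thetaIdx n i * thetaIdx n (i + 1))) • (aP i * aM (i + 1)))
            * L i)) ∧
      f (i + 1) = -(((-1 : K) ^ thetaIdx n i) •
          (Lb i * (aM i * aP (i + 1)
              - ((-1 : K) ^ (thetaIdx n i * thetaIdx n (i + 1))) • (aP (i + 1) * aM i))))) ∧
    (∀ i : ℕ, 1 ≤ i → i ≤ n + m →
      e i ∈ Algebra.adjoin K
          {x : A | ∃ j, 1 ≤ j ∧ j ≤ n + m ∧ (x = aP j ∨ x = aM j ∨ x = L j ∨ x = Lb j)} ∧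
      f i ∈ Algebra.adjoin K
          {x : A | ∃ j, 1 ≤ j ∧ j ≤ n + m ∧ (x = aP j ∨ x = aM j ∨ x = L j ∨ x = Lb j)} ∧
      k i ∈ Algebra.adjoin K
          {x : A | ∃ j, 1 ≤ j ∧ j ≤ n + m ∧ (x = aP j ∨ x = aM j ∨ x = L j ∨ x = Lb j)} ∧
      kb i ∈ Algebra.adjoin K
          {x : A | ∃ j, 1 ≤ j ∧ j ≤ n + m ∧ (x = aP j ∨ x = aM j ∨ x = L j ∨ x = Lb j)}) := by
  clear heSerre hfSerre heAdd hfAdd hesq hfsq hee hff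
  -- scalars
  have hqq : q - q⁻¹ ≠ 0 := by
    intro h
    apply hq1
    have : q = q⁻¹ := sub_eq_zero.mp h
    rw [pow_two]
    nth_rewrite 2 [this]
    exact mul_inv_cancel₀ hq0
  have hQ0 : ∀ i, qc i ≠ 0 := by
    intro i; rw [hqc]; split_ifs
    · exact hq0
    · exact inv_ne_zero hq0
  have hσ : ∀ i, (q - q⁻¹)⁻¹ * (qc i - (qc i)⁻¹) = (-1 : K) ^ thetaIdx n i := by
    intro i; rw [hqc]; unfold thetaIdx; split_ifs
    · simpa using inv_mul_cancel₀ hqq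
    · rw [inv_inv, ← neg_sub q q⁻¹, mul_neg, inv_mul_cancel₀ hqq, pow_one]
  have hσσ : ∀ i, (-1 : K) ^ thetaIdx n i * (-1 : K) ^ thetaIdx n i = 1 := by
    intro i; rw [← mul_pow]; simp
  have hss : ∀ i, (-1 : K) ^ (thetaIdx n i * thetaIdx n (i + 1)) = (-1 : K) ^ thetaIdx n i := by
    intro i; unfold thetaIdx; split_ifs <;> first | omega | simp
  have hp1 : ∀ i, 1 ≤ i → i ≠ n + 1 → (-1 : ℤ) ^ pIdx n i = 1 := by
    intro i h1 h2; unfold pIdx thetaIdx; split_ifs <;> first | omega | simp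
  have hpp : ∀ i j, 1 ≤ i → 1 ≤ j → i ≠ j → (-1 : K) ^ (pIdx n i * pIdx n j) = 1 := by
    intro i j h1 h2 h3
    unfold pIdx thetaIdx
    split_ifs <;> first | omega | norm_num
  have hpd : ∀ i, (-1 : K) ^ thetaIdx n i * (-1 : K) ^ (pIdx n (i + 1) * pIdx n (i + 1))
      = (-1 : K) ^ thetaIdx n (i + 1) := by
    intro i
    unfold pIdx thetaIdx
    simp only [Nat.add_sub_cancel]
    split_ifs <;> first | omega | norm_num
  have hα0 : ∀ i j, i ≠ j → i + 1 ≠ j → i ≠ j + 1 → alphaMat n i j = 0 := by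
    intro i j h1 h2 h3; simp [alphaMat, h1, h2, h3]
  have hαd : ∀ i, alphaMat n (i + 1) i = -1 := by
    intro i; simp [alphaMat]; omega
  have hαu : ∀ i, alphaMat n i (i + 1) = -(-1) ^ pIdx n i := by
    intro i; simp [alphaMat]; omega
  have hqαu : ∀ i, 1 ≤ i → q ^ alphaMat n i (i + 1)
      = if thetaIdx n (i - 1) = 0 then (qc i)⁻¹ else qc i := by
    intro i h1
    rw [hαu, hqc]
    unfold pIdx thetaIdx
    by_cases h : i - 1 ≤ n <;> by_cases hh : i ≤ n <;> first | omega | simp [h, hh]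
  -- commuting e and f
  have hefc : ∀ i j, 1 ≤ i → i ≤ n + m → 1 ≤ j → j ≤ n + m → i ≠ j → e i * f j = f j * e i := by
    intro i j h1 h2 h3 h4 h5
    have := hef i j h1 h2 h3 h4
    rw [hpp i j h1 h3 h5, one_smul, if_neg h5, zero_smul] at this
    exact sub_eq_zero.mp this
  -- the signed Cartan elements
  obtain ⟨κ, hκ⟩ : ∃ κ : ℕ → A, ∀ j, κ j = if thetaIdx n (j - 1) = 0 then k j else kb j :=
    ⟨_, fun _ => rfl⟩
  obtain ⟨κb, hκb⟩ : ∃ κb : ℕ → A, ∀ j, κb j = if thetaIdx n (j - 1) = 0 then kb j else k j :=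
    ⟨_, fun _ => rfl⟩
  have hκinv : ∀ j, 1 ≤ j → j ≤ n + m → κ j * κb j = 1 ∧ κb j * κ j = 1 := by
    intro j h1 h2
    rw [hκ, hκb]
    split_ifs
    · exact hkinv j h1 h2
    · exact (hkinv j h1 h2).symm
  -- transfer of commutation from k to κ
  have hκSC : ∀ (j : ℕ) (c d : K) (y : A), 1 ≤ j → j ≤ n + m → c ≠ 0 →
      SC c (k j) y → d = (if thetaIdx n (j - 1) = 0 then c else c⁻¹) → SC d (κ j) y := by
    intro j c d y h1 h2 hc h hd
    rw [hκ, hd]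
    split_ifs
    · exact h
    · exact h.invSC hc (hkinv j h1 h2).1 (hkinv j h1 h2).2
  have hκbSC : ∀ (j : ℕ) (d : K) (y : A), 1 ≤ j → j ≤ n + m → d ≠ 0 →
      SC d (κ j) y → SC d⁻¹ (κb j) y := by
    intro j d y h1 h2 hd h
    exact h.invSC hd (hκinv j h1 h2).1 (hκinv j h1 h2).2
  have hκk : ∀ i j, 1 ≤ i → i ≤ n + m → 1 ≤ j → j ≤ n + m → SC (1 : K) (κ i) (k j) := by
    intro i j h1 h2 h3 h4
    exact hκSC i 1 1 _ h1 h2 one_ne_zero (SC.of_eq (hkk i j h1 h2 h3 h4)) (by simp)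
  have hκκ : ∀ i j, 1 ≤ i → i ≤ n + m → 1 ≤ j → j ≤ n + m → SC (1 : K) (κ i) (κ j) := by
    intro i j h1 h2 h3 h4
    exact SC.of_eq (SC.eq (hκSC j 1 1 _ h3 h4 one_ne_zero
      (SC.of_eq (hκk i j h1 h2 h3 h4).eq.symm) (by simp)) (K := K)).symm
  have hκe0 : ∀ i j, 1 ≤ i → i + 1 < j → j ≤ n + m → SC (1 : K) (κ i) (e j) := by
    intro i j h1 h2 h3
    refine hκSC i 1 1 _ h1 (by omega) one_ne_zero ?_ (by simp)
    have := hke i j h1 (by omega) (by omega) h3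
    rwa [hα0 i j (by omega) (by omega) (by omega), zpow_zero] at this
  have hκf0 : ∀ i j, 1 ≤ i → i + 1 < j → j ≤ n + m → SC (1 : K) (κ i) (f j) := by
    intro i j h1 h2 h3
    refine hκSC i 1 1 _ h1 (by omega) one_ne_zero ?_ (by simp)
    have := hkf i j h1 (by omega) (by omega) h3
    rwa [hα0 i j (by omega) (by omega) (by omega), neg_zero, zpow_zero] at this
  have hκe : ∀ i, 1 ≤ i → i + 1 ≤ n + m → SC (qc i)⁻¹ (κ i) (e (i + 1)) := by
    intro i h1 h2
    refine hκSC i _ _ _ h1 (by omega) (zpow_ne_zero _ hq0)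
      (hke i (i + 1) h1 (by omega) (by omega) h2) ?_
    rw [hqαu i h1]; split_ifs <;> rfl
  have hκf : ∀ i, 1 ≤ i → i + 1 ≤ n + m → SC (qc i) (κ i) (f (i + 1)) := by
    intro i h1 h2
    refine hκSC i _ _ _ h1 (by omega) (zpow_ne_zero _ hq0)
      (hkf i (i + 1) h1 (by omega) (by omega) h2) ?_
    rw [zpow_neg, hqαu i h1]; split_ifs <;> simp
  have hκed : ∀ i, 1 ≤ i → i + 1 ≤ n + m → SC (qc i)⁻¹ (κ (i + 1)) (e i) := by
    intro i h1 h2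
    refine hκSC (i + 1) _ _ _ (by omega) h2 (zpow_ne_zero _ hq0)
      (hke (i + 1) i (by omega) h2 h1 (by omega)) ?_
    rw [hαd, hqc, Nat.add_sub_cancel]; unfold thetaIdx; by_cases h : i ≤ n <;> simp [h]
  have hκfd : ∀ i, 1 ≤ i → i + 1 ≤ n + m → SC (qc i) (κ (i + 1)) (f i) := by
    intro i h1 h2
    refine hκSC (i + 1) _ _ _ (by omega) h2 (zpow_ne_zero _ hq0)
      (hkf (i + 1) i (by omega) h2 h1 (by omega)) ?_
    rw [hαd, hqc, Nat.add_sub_cancel]; unfold thetaIdx; by_cases h : i ≤ n <;> simp [h]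
  have hκe0' : ∀ i j, 1 ≤ j → j + 1 < i → i ≤ n + m → SC (1 : K) (κ i) (e j) := by
    intro i j h1 h2 h3
    refine hκSC i 1 1 _ (by omega) h3 one_ne_zero ?_ (by simp)
    have := hke i j (by omega) h3 h1 (by omega)
    rwa [hα0 i j (by omega) (by omega) (by omega), zpow_zero] at this
  have hκf0' : ∀ i j, 1 ≤ j → j + 1 < i → i ≤ n + m → SC (1 : K) (κ i) (f j) := by
    intro i j h1 h2 h3
    refine hκSC i 1 1 _ (by omega) h3 one_ne_zero ?_ (by simp)
    have := hkf i j (by omega) h3 h1 (by omega)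
    rwa [hα0 i j (by omega) (by omega) (by omega), neg_zero, zpow_zero] at this
  -- recursions in successor form
  have haM' : ∀ i, 1 ≤ i → i + 1 ≤ n + m →
      aM (i + 1) = aM i * e (i + 1) - (qc i)⁻¹ • (e (i + 1) * aM i) := by
    intro i h1 h2; exact haM (i + 1) (by omega) h2
  have haP' : ∀ i, 1 ≤ i → i + 1 ≤ n + m →
      aP (i + 1) = f (i + 1) * aP i - qc i • (aP i * f (i + 1)) := by
    intro i h1 h2; exact haP (i + 1) (by omega) h2
  have hL' : ∀ i, 1 ≤ i → i + 1 ≤ n + m → L (i + 1) = L i * κ (i + 1) := by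
    intro i h1 h2; rw [hκ]; exact hL (i + 1) (by omega) h2
  have hLb' : ∀ i, 1 ≤ i → i + 1 ≤ n + m → Lb (i + 1) = Lb i * κb (i + 1) := by
    intro i h1 h2; rw [hκb]; exact hLb (i + 1) (by omega) h2
  have hκ1 : κ 1 = k 1 := by rw [hκ]; simp [thetaIdx]
  have hκb1 : κb 1 = kb 1 := by rw [hκb]; simp [thetaIdx]
  -- commutation of a_i^± with far generators
  have hfaM : ∀ i, 1 ≤ i → ∀ j, i < j → j ≤ n + m → SC (1 : K) (f j) (aM i) := by
    intro i h1
    induction i, h1 using Nat.le_induction with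
    | base =>
      intro j h2 h3
      rw [haM1]
      exact SC.of_eq (hefc 1 j le_rfl (by omega) (by omega) h3 (by omega)).symm
    | succ i h1 ih =>
      intro j h2 h3
      have hx := ih j (by omega) h3
      have he : SC (1 : K) (f j) (e (i + 1)) :=
        SC.of_eq (hefc (i + 1) j (by omega) (by omega) (by omega) h3 (by omega)).symm
      rw [haM' i h1 (by omega)]
      simpa only [one_mul] using (hx.mul_rightSC he).comb (d := (qc i)⁻¹) (he.mul_rightSC hx)
  have heaP : ∀ i, 1 ≤ i → ∀ j, i < j → j ≤ n + m → SC (1 : K) (e j) (aP i) := by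
    intro i h1
    induction i, h1 using Nat.le_induction with
    | base =>
      intro j h2 h3
      rw [haP1]
      exact SC.of_eq (hefc j 1 (by omega) h3 le_rfl (by omega) (by omega))
    | succ i h1 ih =>
      intro j h2 h3
      have hx := ih j (by omega) h3
      have he : SC (1 : K) (e j) (f (i + 1)) :=
        SC.of_eq (hefc j (i + 1) (by omega) h3 (by omega) (by omega) (by omega))
      rw [haP' i h1 (by omega)]
      simpa only [one_mul] using (he.mul_rightSC hx).comb (d := qc i) (hx.mul_rightSC he)
  have hκaM0 : ∀ i, 1 ≤ i → ∀ j, i + 1 < j → j ≤ n + m → SC (1 : K) (κ j) (aM i) := by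
    intro i h1
    induction i, h1 using Nat.le_induction with
    | base => intro j h2 h3; rw [haM1]; exact hκe0' j 1 le_rfl h2 h3
    | succ i h1 ih =>
      intro j h2 h3
      have hx := ih j (by omega) h3
      have he := hκe0' j (i + 1) (by omega) h2 h3
      rw [haM' i h1 (by omega)]
      simpa only [one_mul] using (hx.mul_rightSC he).comb (d := (qc i)⁻¹) (he.mul_rightSC hx)
  have hκaP0 : ∀ i, 1 ≤ i → ∀ j, i + 1 < j → j ≤ n + m → SC (1 : K) (κ j) (aP i) := by
    intro i h1
    induction i, h1 using Nat.le_induction with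
    | base => intro j h2 h3; rw [haP1]; exact hκf0' j 1 le_rfl h2 h3
    | succ i h1 ih =>
      intro j h2 h3
      have hx := ih j (by omega) h3
      have he := hκf0' j (i + 1) (by omega) h2 h3
      rw [haP' i h1 (by omega)]
      simpa only [one_mul] using (he.mul_rightSC hx).comb (d := qc i) (hx.mul_rightSC he)
  have hκaM : ∀ i, 1 ≤ i → i + 1 ≤ n + m → SC (qc i)⁻¹ (κ (i + 1)) (aM i) := by
    intro i h1 h2
    obtain rfl | ⟨i, rfl, h3⟩ : i = 1 ∨ ∃ r, i = r + 1 ∧ 1 ≤ r := by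
      rcases Nat.lt_or_ge 1 i with h | h
      · exact Or.inr ⟨i - 1, by omega, by omega⟩
      · exact Or.inl (by omega)
    · rw [haM1]; exact hκed 1 le_rfl h2
    · have hx := hκaM0 i h3 (i + 1 + 1) (by omega) h2
      have he := hκed (i + 1) h1 h2
      rw [haM' i h3 (by omega)]
      simpa only [one_mul, mul_one] using
        (hx.mul_rightSC he).comb (d := (qc i)⁻¹)
          (by simpa only [one_mul, mul_one] using he.mul_rightSC hx)
  have hκaP : ∀ i, 1 ≤ i → i + 1 ≤ n + m → SC (qc i) (κ (i + 1)) (aP i) := by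
    intro i h1 h2
    obtain rfl | ⟨i, rfl, h3⟩ : i = 1 ∨ ∃ r, i = r + 1 ∧ 1 ≤ r := by
      rcases Nat.lt_or_ge 1 i with h | h
      · exact Or.inr ⟨i - 1, by omega, by omega⟩
      · exact Or.inl (by omega)
    · rw [haP1]; exact hκfd 1 le_rfl h2
    · have hx := hκaP0 i h3 (i + 1 + 1) (by omega) h2
      have he := hκfd (i + 1) h1 h2
      rw [haP' i h3 (by omega)]
      simpa only [one_mul, mul_one] using
        (he.mul_rightSC hx).comb (d := qc i)
          (by simpa only [one_mul, mul_one] using hx.mul_rightSC he)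
  -- the elements L
  have hLκ : ∀ i, 1 ≤ i → i ≤ n + m → ∀ j, 1 ≤ j → j ≤ n + m → SC (1 : K) (L i) (κ j) := by
    intro i h1
    induction i, h1 using Nat.le_induction with
    | base => intro h2 j h3 h4; rw [hL1, ← hκ1]; exact hκκ 1 j le_rfl h2 h3 h4
    | succ i h1 ih =>
      intro h2 j h3 h4
      rw [hL' i h1 h2]
      simpa only [one_mul] using
        (ih (by omega) j h3 h4).mul_leftSC (hκκ (i + 1) j (by omega) h2 h3 h4)
  have hκbLSC : ∀ i j, 1 ≤ i → i ≤ n + m → 1 ≤ j → j ≤ n + m → SC (1 : K) (κb j) (L i) := by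
    intro i j h1 h2 h3 h4
    have := hκbSC j 1 (L i) h3 h4 one_ne_zero (SC.of_eq (hLκ i h1 h2 j h3 h4).eq.symm)
    rwa [inv_one] at this
  have hLinv : ∀ i, 1 ≤ i → i ≤ n + m → L i * Lb i = 1 ∧ Lb i * L i = 1 := by
    intro i h1
    induction i, h1 using Nat.le_induction with
    | base => intro h2; rw [hL1, hLb1]; exact hkinv 1 le_rfl h2
    | succ i h1 ih =>
      intro h2
      obtain ⟨ih1, ih2⟩ := ih (by omega)
      obtain ⟨hk1, hk2⟩ := hκinv (i + 1) (by omega) h2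
      have hc := (hLκ i h1 (by omega) (i + 1) (by omega) h2).eq
      have hcb := (hκbLSC i (i + 1) h1 (by omega) (by omega) h2).eq
      rw [hL' i h1 h2, hLb' i h1 h2]
      constructor
      · have h3 : SC (1 : K) (Lb i) (κ (i + 1)) := by
          have := (hLκ i h1 (by omega) (i + 1) (by omega) h2).invSC one_ne_zero ih1 ih2
          rwa [inv_one] at this
        rw [mul_assoc, ← mul_assoc (κ (i + 1)), ← h3.eq, mul_assoc (Lb i), hk1, mul_one, ih1]
      · rw [mul_assoc, ← mul_assoc (κb (i + 1)), hcb, mul_assoc (L i), hk2, mul_one, ih2]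
  have hLe0 : ∀ i, 1 ≤ i → ∀ j, i + 1 < j → j ≤ n + m → SC (1 : K) (L i) (e j) := by
    intro i h1
    induction i, h1 using Nat.le_induction with
    | base => intro j h2 h3; rw [hL1, ← hκ1]; exact hκe0 1 j le_rfl h2 h3
    | succ i h1 ih =>
      intro j h2 h3
      rw [hL' i h1 (by omega)]
      simpa only [one_mul] using
        (ih j (by omega) h3).mul_leftSC (hκe0 (i + 1) j (by omega) h2 h3)
  have hLf0 : ∀ i, 1 ≤ i → ∀ j, i + 1 < j → j ≤ n + m → SC (1 : K) (L i) (f j) := by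
    intro i h1
    induction i, h1 using Nat.le_induction with
    | base => intro j h2 h3; rw [hL1, ← hκ1]; exact hκf0 1 j le_rfl h2 h3
    | succ i h1 ih =>
      intro j h2 h3
      rw [hL' i h1 (by omega)]
      simpa only [one_mul] using
        (ih j (by omega) h3).mul_leftSC (hκf0 (i + 1) j (by omega) h2 h3)
  have hLe : ∀ i, 1 ≤ i → i + 1 ≤ n + m → SC (qc i)⁻¹ (L i) (e (i + 1)) := by
    intro i h1 h2
    obtain rfl | ⟨i, rfl, h3⟩ : i = 1 ∨ ∃ r, i = r + 1 ∧ 1 ≤ r := by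
      rcases Nat.lt_or_ge 1 i with h | h
      · exact Or.inr ⟨i - 1, by omega, by omega⟩
      · exact Or.inl (by omega)
    · rw [hL1, ← hκ1]; exact hκe 1 le_rfl h2
    · rw [hL' i h3 (by omega)]
      simpa only [one_mul] using
        (hLe0 i h3 (i + 1 + 1) (by omega) h2).mul_leftSC (hκe (i + 1) h1 h2)
  have hLf : ∀ i, 1 ≤ i → i + 1 ≤ n + m → SC (qc i) (L i) (f (i + 1)) := by
    intro i h1 h2
    obtain rfl | ⟨i, rfl, h3⟩ : i = 1 ∨ ∃ r, i = r + 1 ∧ 1 ≤ r := by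
      rcases Nat.lt_or_ge 1 i with h | h
      · exact Or.inr ⟨i - 1, by omega, by omega⟩
      · exact Or.inl (by omega)
    · rw [hL1, ← hκ1]; exact hκf 1 le_rfl h2
    · rw [hL' i h3 (by omega)]
      simpa only [one_mul] using
        (hLf0 i h3 (i + 1 + 1) (by omega) h2).mul_leftSC (hκf (i + 1) h1 h2)
  have hLbe : ∀ i, 1 ≤ i → i + 1 ≤ n + m → SC (qc i) (Lb i) (e (i + 1)) := by
    intro i h1 h2
    have := (hLe i h1 h2).invSC (inv_ne_zero (hQ0 i)) (hLinv i h1 (by omega)).1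
      (hLinv i h1 (by omega)).2
    rwa [inv_inv] at this
  have hLbf : ∀ i, 1 ≤ i → i + 1 ≤ n + m → SC (qc i)⁻¹ (Lb i) (f (i + 1)) := by
    intro i h1 h2
    exact (hLf i h1 h2).invSC (hQ0 i) (hLinv i h1 (by omega)).1 (hLinv i h1 (by omega)).2
  -- the main commutator
  have hC : ∀ i, 1 ≤ i → i ≤ n + m →
      aM i * aP i - ((-1 : K) ^ thetaIdx n i) • (aP i * aM i) = (q - q⁻¹)⁻¹ • (L i - Lb i) := by
    intro i h1
    induction i, h1 using Nat.le_induction with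
    | base =>
      intro h2
      have := hef 1 1 le_rfl h2 le_rfl h2
      rw [if_pos rfl] at this
      rw [haM1, haP1, hL1, hLb1, ← hpd 0]
      simpa [thetaIdx] using this
    | succ i h1 ih =>
      intro h2
      have hsgn : ((-1 : K) ^ thetaIdx n i * (q - q⁻¹)⁻¹) * (qc i - (qc i)⁻¹) = 1 := by
        rw [mul_assoc, hσ, hσσ]
      have hef' : e (i + 1) * f (i + 1)
          - ((-1 : K) ^ (pIdx n (i + 1) * pIdx n (i + 1))) • (f (i + 1) * e (i + 1))
          = ((-1 : K) ^ thetaIdx n i * (q - q⁻¹)⁻¹) • (κ (i + 1) - κb (i + 1)) := by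
        rw [hef (i + 1) (i + 1) (by omega) h2 (by omega) h2, if_pos rfl, hκ, hκb,
          Nat.add_sub_cancel]
        unfold thetaIdx
        by_cases h : i ≤ n
        · simp [h]
        · simp only [h, if_false, if_true, one_ne_zero, pow_one, neg_mul, one_mul]
          module
      have hκbx := hκbSC (i + 1) _ _ (by omega) h2 (inv_ne_zero (hQ0 i)) (hκaM i h1 h2)
      rw [inv_inv] at hκbx
      have hκbLb : κb (i + 1) * Lb i = Lb i * κb (i + 1) := by
        have h3 : SC (1 : K) (L i) (κb (i + 1)) :=
          SC.of_eq (hκbLSC i (i + 1) h1 (by omega) (by omega) h2).eq.symm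
        have := h3.invSC one_ne_zero (hLinv i h1 (by omega)).1 (hLinv i h1 (by omega)).2
        rw [inv_one] at this
        exact this.eq.symm
      rw [haM' i h1 h2, haP' i h1 h2, hL' i h1 h2, hLb' i h1 h2, ← hpd i]
      exact stepC (hQ0 i) (hσ i) hsgn (heaP i h1 (i + 1) (by omega) h2).eq
        (hfaM i h1 (i + 1) (by omega) h2).eq (hLe i h1 h2) (hLbe i h1 h2) (hLbf i h1 h2)
        (hκaM i h1 h2) hκbx (hκaP i h1 h2) hef'
        (hLκ i h1 (by omega) (i + 1) (by omega) h2).eq.symm hκbLb (ih (by omega))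
  -- the two formulas
  have hmain : ∀ i : ℕ, 1 ≤ i → i + 1 ≤ n + m →
      e (i + 1) = -(((-1 : K) ^ thetaIdx n i) •
          ((aM (i + 1) * aP i
              - ((-1 : K) ^ (thetaIdx n i * thetaIdx n (i + 1))) • (aP i * aM (i + 1)))
            * L i)) ∧
      f (i + 1) = -(((-1 : K) ^ thetaIdx n i) •
          (Lb i * (aM i * aP (i + 1)
              - ((-1 : K) ^ (thetaIdx n i * thetaIdx n (i + 1))) • (aP (i + 1) * aM i)))) := by
    intro i h1 h2
    rw [hss, haM' i h1 h2, haP' i h1 h2]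
    constructor
    · rw [stepB (hσ i) (heaP i h1 (i + 1) (by omega) h2).eq (hLe i h1 h2) (hLbe i h1 h2)
        (hC i h1 (by omega)), neg_mul, smul_neg, neg_neg, smul_mul_assoc, smul_smul, hσσ, one_smul,
        mul_assoc, (hLinv i h1 (by omega)).2, mul_one]
    · rw [stepD (hQ0 i) (hσ i) (hfaM i h1 (i + 1) (by omega) h2).eq (hLf i h1 h2) (hLbf i h1 h2)
        (hC i h1 (by omega)), mul_neg, smul_neg, neg_neg, mul_smul_comm, smul_smul, hσσ, one_smul,
        ← mul_assoc, (hLinv i h1 (by omega)).2, one_mul]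
  refine ⟨hmain, ?_⟩
  generalize hS : Algebra.adjoin K
    {x : A | ∃ j, 1 ≤ j ∧ j ≤ n + m ∧ (x = aP j ∨ x = aM j ∨ x = L j ∨ x = Lb j)} = S
  have hmem : ∀ j, 1 ≤ j → j ≤ n + m → aP j ∈ S ∧ aM j ∈ S ∧ L j ∈ S ∧ Lb j ∈ S := by
    intro j h1 h2
    rw [← hS]
    refine ⟨?_, ?_, ?_, ?_⟩ <;> refine Algebra.subset_adjoin ⟨j, h1, h2, ?_⟩ <;> simp
  intro i h1 h2
  obtain rfl | ⟨i, rfl, h3⟩ : i = 1 ∨ ∃ r, i = r + 1 ∧ 1 ≤ r := by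
    rcases Nat.lt_or_ge 1 i with h | h
    · exact Or.inr ⟨i - 1, by omega, by omega⟩
    · exact Or.inl (by omega)
  · rw [← haM1, ← haP1, ← hL1, ← hLb1]
    obtain ⟨m1, m2, m3, m4⟩ := hmem 1 le_rfl h2
    exact ⟨m2, m1, m3, m4⟩
  · obtain ⟨m1, m2, m3, m4⟩ := hmem i h3 (by omega)
    obtain ⟨mm1, mm2, mm3, mm4⟩ := hmem (i + 1) h1 h2
    have hκS : κ (i + 1) ∈ S := by
      have : κ (i + 1) = Lb i * L (i + 1) := by
        rw [hL' i h3 h2, ← mul_assoc, (hLinv i h3 (by omega)).2, one_mul]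
      rw [this]; exact S.mul_mem m4 mm3
    have hκbS : κb (i + 1) ∈ S := by
      have : κb (i + 1) = L i * Lb (i + 1) := by
        rw [hLb' i h3 h2, ← mul_assoc, (hLinv i h3 (by omega)).1, one_mul]
      rw [this]; exact S.mul_mem m3 mm4
    refine ⟨?_, ?_, ?_⟩
    · rw [(hmain i h3 h2).1]
      exact S.neg_mem (S.smul_mem (S.mul_mem (S.sub_mem (S.mul_mem mm2 m1)
        (S.smul_mem (S.mul_mem m1 mm2) _)) m3) _)
    · rw [(hmain i h3 h2).2]
      exact S.neg_mem (S.smul_mem (S.mul_mem m4 (S.sub_mem (S.mul_mem m2 mm1)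
        (S.smul_mem (S.mul_mem mm1 m2) _))) _)
    · rw [hκ] at hκS
      rw [hκb] at hκbS
      split_ifs at hκS hκbS
      · exact ⟨hκS, hκbS⟩
      · exact ⟨hκbS, hκS⟩
end

section
/- (Theorem, converse direction: the Cartan–Kac relations follow from relations (38).) For all 1 ≤ i, j ≤ N: e_i·f_j − (−1)^{p_ip_j}·f_j·e_i = δ_{ij}·(q − q̄)⁻¹·(k_i − k̄_i), and moreover k_i·e_j = q^{α_{ij}}·e_j·k_i and k_i·f_j = q^{−α_{ij}}·f_j·k_i. -/
/-- `x` and `y` commute up to the scalar `c`. -/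
def QC {K A : Type*} [Field K] [Ring A] [Algebra K A] (c : K) (x y : A) : Prop :=
  x * y = c • (y * x)

namespace QC
variable {K A : Type*} [Field K] [Ring A] [Algebra K A] {c d : K} {x y z : A}

theorem mul_right (h : QC c x y) (h' : QC d x z) : QC (c * d) x (y * z) := by
  unfold QC at *
  rw [← mul_assoc, h, smul_mul_assoc, mul_assoc, h', mul_smul_comm, smul_smul, mul_assoc]

theorem mul_left (h : QC c x z) (h' : QC d y z) : QC (c * d) (x * y) z := by
  unfold QC at *
  rw [mul_assoc, h', mul_smul_comm, ← mul_assoc, h, smul_mul_assoc, smul_smul, mul_assoc,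
    mul_comm c d]

theorem sub_smul_right (t : K) (h : QC c x y) (h' : QC c x z) : QC c x (y - t • z) := by
  unfold QC at *
  rw [mul_sub, sub_mul, mul_smul_comm, h, h', smul_sub, smul_mul_assoc, smul_comm]

theorem neg_smul_right (t : K) (h : QC c x y) : QC c x (-(t • y)) := by
  unfold QC at *
  rw [mul_neg, neg_mul, mul_smul_comm, h, smul_neg, smul_mul_assoc, smul_comm]

theorem symm (hc : c ≠ 0) (h : QC c x y) : QC c⁻¹ y x := by
  unfold QC at *
  rw [h, smul_smul, inv_mul_cancel₀ hc, one_smul]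

theorem neg_smul_left (t : K) (h : QC c x y) : QC c (-(t • x)) y := by
  unfold QC at *
  rw [mul_neg, neg_mul, smul_mul_assoc, h, smul_neg, mul_smul_comm, smul_comm]

theorem inv_left {xb : A} (hc : c ≠ 0) (h1 : x * xb = 1) (h2 : xb * x = 1) (h : QC c x y) :
    QC c⁻¹ xb y := by
  unfold QC at *
  have h3 : xb * (x * y) * xb = c • (xb * (y * x) * xb) := by
    rw [h, mul_smul_comm, smul_mul_assoc]
  have h4 : xb * (x * y) * xb = y * xb := by rw [← mul_assoc xb, h2, one_mul]
  have h5 : xb * (y * x) * xb = xb * y := by rw [mul_assoc, mul_assoc, h1, mul_one]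
  rw [← h4, h3, h5, smul_smul, inv_mul_cancel₀ hc, one_smul]

theorem cast (h : QC c x y) (e : c = d) : QC d x y := e ▸ h

end QC

theorem diag_aux {K A : Type*} [Field K] [Ring A] [Algebra K A] (q c s t σ : K) (hq : q ≠ 0)
    (hs : s = 1 ∨ s = -1) (ht : t = 1 ∨ t = -1) (hσ : σ = 1 ∨ σ = -1)
    (am ap bm bp X L L' M M' : A)
    (h1 : X * am = (s * σ * q⁻¹) • (am * X) + s • (L' * bm))
    (h2 : X * bp = (t * σ * q) • (bp * X) - σ • (M' * ap))
    (h3 : am * M' = q • (M' * am)) (h4 : bp * L' = q⁻¹ • (L' * bp))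
    (h5 : am * ap = s • (ap * am) + c • (L - L'))
    (h6 : bm * bp = t • (bp * bm) + c • (M - M')) (h7 : L' * M' = M' * L') :
    X * (am * bp - σ • (bp * am)) - (s * t) • ((am * bp - σ • (bp * am)) * X)
      = (s * c) • (L' * M - M' * L) := by
  have e1 : X * (am * bp) = (s * t) • (am * (bp * X)) - (s * σ * σ) • (M' * (am * ap))
      + s • (L' * (bm * bp)) := by
    have : am * (M' * ap) = q • (M' * (am * ap)) := by
      rw [← mul_assoc, h3, smul_mul_assoc, mul_assoc]
    rw [← mul_assoc, h1, add_mul, smul_mul_assoc, smul_mul_assoc, mul_assoc am, h2, mul_sub,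
      mul_smul_comm, mul_smul_comm, this]
    simp only [mul_assoc]
    rcases hσ with rfl | rfl <;> match_scalars <;> field_simp
  have e2 : X * (bp * am) = (s * t) • (bp * (am * X)) + (s * t * σ) • (L' * (bp * bm))
      - σ • (M' * (ap * am)) := by
    have : bp * (L' * bm) = q⁻¹ • (L' * (bp * bm)) := by
      rw [← mul_assoc, h4, smul_mul_assoc, mul_assoc]
    rw [← mul_assoc, h2, sub_mul, smul_mul_assoc, smul_mul_assoc, mul_assoc bp, h1, mul_add,
      mul_smul_comm, mul_smul_comm, this]
    simp only [mul_assoc]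
    rcases hσ with rfl | rfl <;> match_scalars <;> field_simp
  rw [mul_sub, mul_smul_comm, e1, e2, h5, h6, sub_mul, smul_mul_assoc]
  simp only [mul_add, mul_sub, mul_smul_comm, mul_assoc, h7]
  rcases hσ with rfl | rfl <;> rcases hs with rfl | rfl <;> rcases ht with rfl | rfl <;> module

theorem thetaIdx_cases (n i : ℕ) : thetaIdx n i = 0 ∨ thetaIdx n i = 1 := by
  unfold thetaIdx; split_ifs <;> simp

/-- Theorem, converse direction: the Cartan–Kac relations follow from the
relations (38). -/
theorem stmt16
    (K : Type*) (A : Type*) [Field K] [Ring A] [Algebra K A]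
    (n m : ℕ) (hm : 1 ≤ m)
    (q : K) (hq0 : q ≠ 0) (hq1 : q ^ 2 ≠ 1)
    (aP aM L Lb : ℕ → A)
    -- L_i L̄_i = L̄_i L_i = 1
    (hLinv : ∀ i, 1 ≤ i → i ≤ n + m → L i * Lb i = 1 ∧ Lb i * L i = 1)
    -- all L_i, L̄_j commute with one another
    (hLcomm : ∀ i j, 1 ≤ i → i ≤ n + m → 1 ≤ j → j ≤ n + m →
      L i * L j = L j * L i ∧ L i * Lb j = Lb j * L i ∧ Lb i * Lb j = Lb j * Lb i)
    -- L_i a_j^- = q^{1+(−1)^{θ_i}δ_{ij}} a_j^- L_i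
    (hLaM : ∀ i j, 1 ≤ i → i ≤ n + m → 1 ≤ j → j ≤ n + m →
      L i * aM j
        = (q ^ ((1 : ℤ) + (-1 : ℤ) ^ thetaIdx n i * (if i = j then 1 else 0))) •
            (aM j * L i))
    -- L_i a_j^+ = q^{−(1+(−1)^{θ_i}δ_{ij})} a_j^+ L_i
    (hLaP : ∀ i j, 1 ≤ i → i ≤ n + m → 1 ≤ j → j ≤ n + m →
      L i * aP j
        = (q ^ (-((1 : ℤ) + (-1 : ℤ) ^ thetaIdx n i * (if i = j then 1 else 0)))) •
            (aP j * L i))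
    -- (38c)
    (h38c : ∀ i, 1 ≤ i → i ≤ n + m →
      aM i * aP i - ((-1 : K) ^ thetaIdx n i) • (aP i * aM i)
        = (q - q⁻¹)⁻¹ • (L i - Lb i))
    -- the encoding aa 1 = a^+, aa (-1) = a^-
    (aa : ℤ → ℕ → A) (haaP : ∀ j, aa 1 j = aP j) (haaM : ∀ j, aa (-1) j = aM j)
    -- (38d): the triple relations
    (h38d : ∀ ξ η : ℤ, (ξ = 1 ∨ ξ = -1) → (η = 1 ∨ η = -1) →
      ∀ i k : ℕ, 1 ≤ i → 1 ≤ (i : ℤ) + ξ → (i : ℤ) + ξ ≤ (n + m : ℤ) →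
        1 ≤ k → k ≤ n + m →
        (aa η i * aa (-η) ((i : ℤ) + ξ).toNat
            - ((-1 : K) ^ (thetaIdx n i * thetaIdx n ((i : ℤ) + ξ).toNat)) •
                (aa (-η) ((i : ℤ) + ξ).toNat * aa η i)) * aa η k
          - (((-1 : K) ^ ((thetaIdx n i + thetaIdx n ((i : ℤ) + ξ).toNat) * thetaIdx n k))
              * q ^ (ξ * (1 + (-1 : ℤ) ^ thetaIdx n i * (if i = k then 1 else 0)))) •
              (aa η k *
                (aa η i * aa (-η) ((i : ℤ) + ξ).toNat
                  - ((-1 : K) ^ (thetaIdx n i * thetaIdx n ((i : ℤ) + ξ).toNat)) •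
                      (aa (-η) ((i : ℤ) + ξ).toNat * aa η i)))
        = ((if thetaIdx n k = 0 then (1 : K) else (η : K))
              * (if (k : ℤ) = (i : ℤ) + ξ then 1 else 0)) •
            ((if ξ * η = 1 then Lb k else L k) * aa η i))
    -- (38e)
    (h38e : 2 ≤ n + m →
      aP 1 * aP 2 - (((-1 : K) ^ (thetaIdx n 1 * thetaIdx n 2)) * q) • (aP 2 * aP 1) = 0 ∧
      aM 1 * aM 2 - (((-1 : K) ^ (thetaIdx n 1 * thetaIdx n 2)) * q) • (aM 2 * aM 1) = 0)
    (h38e1 : n = 0 → aP 1 * aP 1 = 0 ∧ aM 1 * aM 1 = 0)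
    -- the Chevalley generators, defined from the CAGs
    (e f : ℕ → A)
    (he1 : e 1 = aM 1) (hf1 : f 1 = aP 1)
    (he : ∀ i, 1 ≤ i → i + 1 ≤ n + m →
      e (i + 1) = -(((-1 : K) ^ thetaIdx n i) •
          ((aM (i + 1) * aP i
              - ((-1 : K) ^ (thetaIdx n i * thetaIdx n (i + 1))) • (aP i * aM (i + 1)))
            * L i)))
    (hf : ∀ i, 1 ≤ i → i + 1 ≤ n + m →
      f (i + 1) = -(((-1 : K) ^ thetaIdx n i) •
          (Lb i * (aM i * aP (i + 1)
              - ((-1 : K) ^ (thetaIdx n i * thetaIdx n (i + 1))) • (aP (i + 1) * aM i)))))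
    -- the Cartan elements k_i, k̄_i, defined from the L_i
    (k kb : ℕ → A)
    (hk1 : k 1 = L 1) (hkb1 : kb 1 = Lb 1)
    (hk : ∀ i, 2 ≤ i → i ≤ n + m →
      k i = if thetaIdx n (i - 1) = 0 then L i * Lb (i - 1) else Lb i * L (i - 1))
    (hkb : ∀ i, 2 ≤ i → i ≤ n + m →
      kb i = if thetaIdx n (i - 1) = 0 then Lb i * L (i - 1) else L i * Lb (i - 1))
    :
    ∀ i j : ℕ, 1 ≤ i → i ≤ n + m → 1 ≤ j → j ≤ n + m →
      (e i * f j - ((-1 : K) ^ (pIdx n i * pIdx n j)) • (f j * e i)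
        = (if i = j then (q - q⁻¹)⁻¹ else 0) • (k i - kb i)) ∧
      k i * e j = (q ^ alphaMat n i j) • (e j * k i) ∧
      k i * f j = (q ^ (-alphaMat n i j)) • (f j * k i) := by
  have hqz : ∀ z : ℤ, q ^ z ≠ 0 := fun z => zpow_ne_zero z hq0
  -- the weights of the Cartan elements
  have LM : ∀ i j, 1 ≤ i → i ≤ n + m → 1 ≤ j → j ≤ n + m →
      QC (q ^ ((1 : ℤ) + (-1 : ℤ) ^ thetaIdx n i * (if i = j then 1 else 0))) (L i) (aM j) := hLaM
  have LP : ∀ i j, 1 ≤ i → i ≤ n + m → 1 ≤ j → j ≤ n + m →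
      QC (q ^ (-((1 : ℤ) + (-1 : ℤ) ^ thetaIdx n i * (if i = j then 1 else 0)))) (L i) (aP j) :=
    hLaP
  have LE : ∀ i j, 1 ≤ i → i ≤ n + m → 1 ≤ j → j + 1 ≤ n + m →
      QC (q ^ ((-1 : ℤ) ^ thetaIdx n i * ((if i = j + 1 then 1 else 0) - (if i = j then 1 else 0))))
        (L i) (aM (j + 1) * aP j
          - ((-1 : K) ^ (thetaIdx n j * thetaIdx n (j + 1))) • (aP j * aM (j + 1))) := by
    intro i j hi hi' hj hj'
    have A1 := LM i (j + 1) hi hi' (by omega) hj'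
    have A2 := LP i j hi hi' hj (by omega)
    refine QC.sub_smul_right _ ((A1.mul_right A2).cast ?_) ((A2.mul_right A1).cast ?_)
    all_goals rw [← zpow_add₀ hq0]; congr 1; ring
  have LF : ∀ i j, 1 ≤ i → i ≤ n + m → 1 ≤ j → j + 1 ≤ n + m →
      QC (q ^ ((-1 : ℤ) ^ thetaIdx n i * ((if i = j then 1 else 0) - (if i = j + 1 then 1 else 0))))
        (L i) (aM j * aP (j + 1)
          - ((-1 : K) ^ (thetaIdx n j * thetaIdx n (j + 1))) • (aP (j + 1) * aM j)) := by
    intro i j hi hi' hj hj'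
    have A1 := LP i (j + 1) hi hi' (by omega) hj'
    have A2 := LM i j hi hi' hj (by omega)
    refine QC.sub_smul_right _ ((A2.mul_right A1).cast ?_) ((A1.mul_right A2).cast ?_)
    all_goals rw [← zpow_add₀ hq0]; congr 1; ring
  have LL : ∀ i j, 1 ≤ i → i ≤ n + m → 1 ≤ j → j ≤ n + m → QC (1 : K) (L i) (L j) := by
    intro i j hi hi' hj hj'
    unfold QC; rw [one_smul]; exact (hLcomm i j hi hi' hj hj').1
  have LLb : ∀ i j, 1 ≤ i → i ≤ n + m → 1 ≤ j → j ≤ n + m → QC (1 : K) (L i) (Lb j) := by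
    intro i j hi hi' hj hj'
    unfold QC; rw [one_smul]; exact (hLcomm i j hi hi' hj hj').2.1
  -- passing from the weights of `L` to those of `Lb`
  have toLb : ∀ i (z : ℤ) (x : A), 1 ≤ i → i ≤ n + m → QC (q ^ z) (L i) x →
      QC (q ^ (-z)) (Lb i) x := by
    intro i z x hi hi' h
    exact (h.inv_left (hqz z) (hLinv i hi hi').1 (hLinv i hi hi').2).cast (zpow_neg q z).symm
  have flip : ∀ (z : ℤ) (x y : A), QC (q ^ z) x y → QC (q ^ (-z)) y x := by
    intro z x y h
    exact (h.symm (hqz z)).cast (zpow_neg q z).symm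
  -- the weights of the Chevalley generators
  have wE : ∀ i j, 1 ≤ i → i ≤ n + m → 1 ≤ j → j ≤ n + m →
      QC (q ^ ((if j = 1 then 1 else 0) + (-1 : ℤ) ^ thetaIdx n i *
        ((if i = j then 1 else 0) - (if i + 1 = j then 1 else 0)))) (L i) (e j) := by
    intro i j hi hi' hj hj'
    obtain rfl | ⟨j, rfl, hj1⟩ : j = 1 ∨ ∃ j', j = j' + 1 ∧ 1 ≤ j' := by
      rcases Nat.lt_or_ge 1 j with h | h
      · exact Or.inr ⟨j - 1, by omega, by omega⟩
      · exact Or.inl (by omega)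
    · rw [he1]
      refine (LM i 1 hi hi' hj hj').cast ?_
      have : i ≠ 0 := by omega
      simp [this]
    · rw [he j hj1 hj']
      refine QC.neg_smul_right _ (((LE i j hi hi' hj1 hj').mul_right
        (LL i j hi hi' hj1 (by omega))).cast ?_)
      have : j ≠ 0 := by omega
      simp [this]
  have wF : ∀ i j, 1 ≤ i → i ≤ n + m → 1 ≤ j → j ≤ n + m →
      QC (q ^ (-((if j = 1 then 1 else 0) + (-1 : ℤ) ^ thetaIdx n i *
        ((if i = j then 1 else 0) - (if i + 1 = j then 1 else 0))))) (L i) (f j) := by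
    intro i j hi hi' hj hj'
    obtain rfl | ⟨j, rfl, hj1⟩ : j = 1 ∨ ∃ j', j = j' + 1 ∧ 1 ≤ j' := by
      rcases Nat.lt_or_ge 1 j with h | h
      · exact Or.inr ⟨j - 1, by omega, by omega⟩
      · exact Or.inl (by omega)
    · rw [hf1]
      refine (LP i 1 hi hi' hj hj').cast ?_
      have : i ≠ 0 := by omega
      simp [this]
    · rw [hf j hj1 hj']
      refine QC.neg_smul_right _ (((LLb i j hi hi' hj1 (by omega)).mul_right
        (LF i j hi hi' hj1 hj')).cast ?_)
      have : j ≠ 0 := by omega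
      rw [one_mul]; congr 1
      simp only [Nat.add_eq_right, this, if_false, Nat.add_right_cancel_iff]
      ring
  have kwt : ∀ (w : ℕ → ℤ) (x : A), (∀ i, 1 ≤ i → i ≤ n + m → QC (q ^ (w i)) (L i) x) →
      ∀ i, 1 ≤ i → i + 1 ≤ n + m →
        QC (q ^ ((-1 : ℤ) ^ thetaIdx n i * (w (i + 1) - w i))) (k (i + 1)) x := by
    intro w x h i hi hi'
    have A1 := h i hi (by omega)
    have A2 := h (i + 1) (by omega) hi'
    rw [hk (i + 1) (by omega) hi']
    rcases thetaIdx_cases n i with t | t <;> simp only [Nat.add_sub_cancel, t]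
    · refine (A2.mul_left (toLb _ _ _ hi (by omega) A1)).cast ?_
      rw [← zpow_add₀ hq0]; congr 1; ring
    · refine ((toLb _ _ _ (by omega) hi' A2).mul_left A1).cast ?_
      rw [← zpow_add₀ hq0]; congr 1; ring
  have alpha_succ : ∀ i j, 1 ≤ i → 1 ≤ j → (-1 : ℤ) ^ thetaIdx n i *
      (((if j = 1 then 1 else 0) + (-1 : ℤ) ^ thetaIdx n (i + 1) *
        ((if i + 1 = j then 1 else 0) - (if i + 1 + 1 = j then 1 else 0))) -
       ((if j = 1 then 1 else 0) + (-1 : ℤ) ^ thetaIdx n i *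
        ((if i = j then 1 else 0) - (if i + 1 = j then 1 else 0)))) = alphaMat n (i + 1) j := by
    intro i j hi hj
    unfold alphaMat pIdx
    simp only [Nat.add_sub_cancel, Nat.add_right_cancel_iff]
    rcases thetaIdx_cases n i with t | t <;> rcases thetaIdx_cases n (i + 1) with t' | t' <;>
      rw [t, t'] <;> ring
  have alpha_one : ∀ j, 1 ≤ j → ((if j = 1 then 1 else 0) + (-1 : ℤ) ^ thetaIdx n 1 *
        ((if 1 = j then 1 else 0) - (if 1 + 1 = j then 1 else 0))) = alphaMat n 1 j := by
    intro j hj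
    have h0 : thetaIdx n 0 = 0 := by simp [thetaIdx]
    have h1 : j ≠ 0 := by omega
    unfold alphaMat pIdx
    simp only [Nat.sub_self, h0, zero_add, eq_comm (a := j) (b := 1)]
    have h2 : ¬ (1 = j + 1) := by omega
    simp only [h2, if_false]
    ring
  -- the triple relations in a convenient form
  have T1 : ∀ j l, 1 ≤ j → j + 1 ≤ n + m → 1 ≤ l → l ≤ n + m → l ≠ j + 1 →
      QC (((-1 : K) ^ ((thetaIdx n j + thetaIdx n (j + 1)) * thetaIdx n l))
          * q ^ ((1 : ℤ) + (-1 : ℤ) ^ thetaIdx n j * (if j = l then 1 else 0)))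
        (aM j * aP (j + 1)
          - ((-1 : K) ^ (thetaIdx n j * thetaIdx n (j + 1))) • (aP (j + 1) * aM j)) (aM l) := by
    intro j l hj hj' hl hl' hne
    have h := h38d 1 (-1) (by simp) (by simp) j l hj (by omega) (by omega) hl hl'
    have t : ((j : ℤ) + 1).toNat = j + 1 := by omega
    have hne' : ¬ ((l : ℤ) = (j : ℤ) + 1) := by omega
    rw [t] at h
    simp only [haaM, neg_neg, haaP, hne', if_false, mul_zero, zero_smul, one_mul] at h
    exact sub_eq_zero.mp h
  have T2 : ∀ i l, 1 ≤ i → i + 1 ≤ n + m → 1 ≤ l → l ≤ n + m →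
      (aM (i + 1) * aP i
          - ((-1 : K) ^ (thetaIdx n i * thetaIdx n (i + 1))) • (aP i * aM (i + 1))) * aP l =
      (((-1 : K) ^ ((thetaIdx n i + thetaIdx n (i + 1)) * thetaIdx n l))
          * q ^ ((1 : ℤ) + (-1 : ℤ) ^ thetaIdx n i * (if i = l then 1 else 0))) •
        (aP l * (aM (i + 1) * aP i
          - ((-1 : K) ^ (thetaIdx n i * thetaIdx n (i + 1))) • (aP i * aM (i + 1))))
      - ((-1 : K) ^ (thetaIdx n i * thetaIdx n (i + 1)) * (if l = i + 1 then 1 else 0)) •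
        (Lb l * aP i) := by
    intro i l hi hi' hl hl'
    have h := h38d 1 1 (by simp) (by simp) i l hi (by omega) (by omega) hl hl'
    have t : ((i : ℤ) + 1).toNat = i + 1 := by omega
    have hne' : ((l : ℤ) = (i : ℤ) + 1) ↔ l = i + 1 := by omega
    rw [t] at h
    simp only [haaM, haaP, hne', one_mul, if_true, Int.cast_one, ite_self] at h
    generalize (((-1 : K) ^ ((thetaIdx n i + thetaIdx n (i + 1)) * thetaIdx n l))
          * q ^ ((1 : ℤ) + (-1 : ℤ) ^ thetaIdx n i * (if i = l then 1 else 0))) = C at h ⊢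
    generalize (if l = i + 1 then (1 : K) else 0) = D at h ⊢
    have hσ : (-1 : K) ^ (thetaIdx n i * thetaIdx n (i + 1)) = 1 ∨
        (-1 : K) ^ (thetaIdx n i * thetaIdx n (i + 1)) = -1 := neg_one_pow_eq_or K _
    generalize (-1 : K) ^ (thetaIdx n i * thetaIdx n (i + 1)) = σ at h hσ ⊢
    have h' := congrArg (fun x => σ • x) h
    simp only [mul_sub, sub_mul, mul_smul_comm, smul_mul_assoc, smul_sub] at h' ⊢
    rcases hσ with rfl | rfl
    · linear_combination (norm := module) (-1 : K) • h'
    · linear_combination (norm := module) (-1 : K) • h'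
  have T3 : ∀ i l, 1 ≤ i → i + 1 ≤ n + m → 1 ≤ l → l ≤ n + m →
      (aM (i + 1) * aP i
          - ((-1 : K) ^ (thetaIdx n i * thetaIdx n (i + 1))) • (aP i * aM (i + 1))) * aM l =
      (((-1 : K) ^ ((thetaIdx n i + thetaIdx n (i + 1)) * thetaIdx n l))
          * q ^ (-((1 : ℤ) + (-1 : ℤ) ^ thetaIdx n (i + 1) * (if i + 1 = l then 1 else 0)))) •
        (aM l * (aM (i + 1) * aP i
          - ((-1 : K) ^ (thetaIdx n i * thetaIdx n (i + 1))) • (aP i * aM (i + 1))))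
      + ((-1 : K) ^ thetaIdx n l * (if l = i then 1 else 0)) • (Lb l * aM (i + 1)) := by
    intro i l hi hi' hl hl'
    have h := h38d (-1) (-1) (by simp) (by simp) (i + 1) l (by omega) (by push_cast; omega)
      (by push_cast; omega) hl hl'
    have t : (((i + 1 : ℕ) : ℤ) + -1).toNat = i := by omega
    have hne' : ((l : ℤ) = ((i + 1 : ℕ) : ℤ) + -1) ↔ l = i := by omega
    have hs : (if thetaIdx n l = 0 then (1 : K) else ((-1 : ℤ) : K)) = (-1 : K) ^ thetaIdx n l := by
      rcases thetaIdx_cases n l with t | t <;> simp [t]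
    rw [t, hs] at h
    simp only [haaM, haaP, hne', neg_neg, one_mul, neg_mul, if_true,
      mul_comm (thetaIdx n (i + 1)) (thetaIdx n i),
      add_comm (thetaIdx n (i + 1)) (thetaIdx n i)] at h
    exact sub_eq_iff_eq_add'.mp h
  intro i j hi hi' hj hj'
  refine ⟨?_, ?_, ?_⟩
  rotate_left
  · change QC _ _ _
    obtain rfl | ⟨i, rfl, hi1⟩ : i = 1 ∨ ∃ i', i = i' + 1 ∧ 1 ≤ i' := by
      rcases Nat.lt_or_ge 1 i with h | h
      · exact Or.inr ⟨i - 1, by omega, by omega⟩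
      · exact Or.inl (by omega)
    · rw [hk1, ← alpha_one j hj]; exact wE 1 j hi hi' hj hj'
    · rw [← alpha_succ i j hi1 hj]
      exact kwt (fun i => (if j = 1 then 1 else 0) + (-1 : ℤ) ^ thetaIdx n i *
        ((if i = j then 1 else 0) - (if i + 1 = j then 1 else 0))) _
        (fun i h h' => wE i j h h' hj hj') i hi1 hi'
  · change QC _ _ _
    obtain rfl | ⟨i, rfl, hi1⟩ : i = 1 ∨ ∃ i', i = i' + 1 ∧ 1 ≤ i' := by
      rcases Nat.lt_or_ge 1 i with h | h
      · exact Or.inr ⟨i - 1, by omega, by omega⟩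
      · exact Or.inl (by omega)
    · rw [hk1, ← alpha_one j hj]; exact wF 1 j hi hi' hj hj'
    · rw [← alpha_succ i j hi1 hj]
      refine (kwt (fun i => -((if j = 1 then 1 else 0) + (-1 : ℤ) ^ thetaIdx n i *
        ((if i = j then 1 else 0) - (if i + 1 = j then 1 else 0)))) _
        (fun i h h' => wF i j h h' hj hj') i hi1 hi').cast ?_
      congr 1; ring
  have h0 : thetaIdx n 0 = 0 := by simp [thetaIdx]
  have sgn : ∀ N : ℕ, ((-1 : K) ^ N)⁻¹ = (-1 : K) ^ N := by
    intro N; rcases neg_one_pow_eq_or K N with h | h <;> rw [h] <;> norm_num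
  have sgn0 : ∀ N : ℕ, (-1 : K) ^ N ≠ 0 := fun N => pow_ne_zero _ (by simp)
  obtain rfl | ⟨i, rfl, hi1⟩ : i = 1 ∨ ∃ i', i = i' + 1 ∧ 1 ≤ i' := by
    rcases Nat.lt_or_ge 1 i with h | h
    · exact Or.inr ⟨i - 1, by omega, by omega⟩
    · exact Or.inl (by omega)
  · obtain rfl | ⟨j, rfl, hj1⟩ : j = 1 ∨ ∃ j', j = j' + 1 ∧ 1 ≤ j' := by
      rcases Nat.lt_or_ge 1 j with h | h
      · exact Or.inr ⟨j - 1, by omega, by omega⟩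
      · exact Or.inl (by omega)
    · rw [he1, hf1, hk1, hkb1, if_pos rfl, ← h38c 1 hi hi']
      simp only [pIdx, Nat.sub_self, h0, zero_add]
      rcases thetaIdx_cases n 1 with t | t <;> simp [t]
    · rw [if_neg (by omega), zero_smul, sub_eq_zero, he1, hf j hj1 hj']
      change QC _ _ _
      refine QC.neg_smul_right _ ?_
      have A1 := T1 j 1 hj1 hj' hi hi' (by omega)
      have A2 := toLb _ _ _ hj1 (by omega) (LM j 1 hj1 (by omega) hi hi')
      refine ((A2.mul_left A1).symm ?_).cast ?_
      · exact mul_ne_zero (hqz _) (mul_ne_zero (sgn0 _) (hqz _))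
      · rw [mul_left_comm, ← zpow_add₀ hq0, neg_add_cancel, zpow_zero, mul_one, sgn]
        simp only [pIdx, Nat.sub_self, h0, zero_add, Nat.add_sub_cancel]
        rw [mul_comm]
  · obtain rfl | ⟨j, rfl, hj1⟩ : j = 1 ∨ ∃ j', j = j' + 1 ∧ 1 ≤ j' := by
      rcases Nat.lt_or_ge 1 j with h | h
      · exact Or.inr ⟨j - 1, by omega, by omega⟩
      · exact Or.inl (by omega)
    · rw [if_neg (by omega), zero_smul, sub_eq_zero, hf1, he i hi1 hi']
      change QC _ _ _
      refine QC.neg_smul_left _ ?_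
      have A1 := T2 i 1 hi1 hi' hj hj'
      rw [if_neg (show ¬ 1 = i + 1 by omega), mul_zero, zero_smul, sub_zero] at A1
      have A2 := LP i 1 hi1 (by omega) hj hj'
      refine (QC.mul_left A1 A2).cast ?_
      rw [mul_assoc, ← zpow_add₀ hq0, add_neg_cancel, zpow_zero, mul_one]
      simp only [pIdx, Nat.sub_self, h0, zero_add, Nat.add_sub_cancel]
    · by_cases hij : i = j
      · subst hij
        have c1 := LE i i hi1 (by omega) hi1 hi'
        have c2 := LF i i hi1 (by omega) hi1 hi'
        have B1 := T3 i i hi1 hi' hi1 (by omega)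
        have B2 := T2 i (i + 1) hi1 hi' hi hi'
        have B3 := (flip _ _ _ (toLb _ _ _ hi hi' (LM (i + 1) i hi hi' hi1 (by omega))))
        have B4 := (flip _ _ _ (toLb _ _ _ hi1 (by omega) (LP i (i + 1) hi1 (by omega) hi hi')))
        have B5 := sub_eq_iff_eq_add'.mp (h38c i hi1 (by omega))
        have B6 := sub_eq_iff_eq_add'.mp (h38c (i + 1) hi hi')
        have B7 := (hLcomm i (i + 1) hi1 (by omega) hi hi').2.2
        have B8 := (hLcomm i (i + 1) hi1 (by omega) hi hi').2.1
        have B9 := (hLcomm (i + 1) i hi hi' hi1 (by omega)).2.1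
        obtain ⟨I1, I2⟩ := hLinv i hi1 (by omega)
        rw [he i hi1 hi', hf i hi1 hi', hk (i + 1) (by omega) hi', hkb (i + 1) (by omega) hi',
          if_pos rfl]
        have hs := neg_one_pow_eq_or K (thetaIdx n i)
        have key := diag_aux q (q - q⁻¹)⁻¹ ((-1 : K) ^ thetaIdx n i) ((-1 : K) ^ thetaIdx n (i + 1))
          ((-1 : K) ^ (thetaIdx n i * thetaIdx n (i + 1))) hq0 hs (neg_one_pow_eq_or K _)
          (neg_one_pow_eq_or K _) (aM i) (aP i) (aM (i + 1)) (aP (i + 1)) _ (L i) (Lb i)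
          (L (i + 1)) (Lb (i + 1))
          (B1.trans (by
            congr 2
            · rcases thetaIdx_cases n i with t | t <;>
                rcases thetaIdx_cases n (i + 1) with t' | t' <;> simp [t, t']
            · simp))
          (B2.trans (by
            congr 2
            · rcases thetaIdx_cases n i with t | t <;>
                rcases thetaIdx_cases n (i + 1) with t' | t' <;> simp [t, t']
            · simp))
          (B3.cast (by simp)) (B4.cast (by simp)) B5 B6 B7
        have hDD := c1.mul_right c2
        have hDD' := c2.mul_right c1
        generalize (aM (i + 1) * aP i
          - ((-1 : K) ^ (thetaIdx n i * thetaIdx n (i + 1))) • (aP i * aM (i + 1))) = X at *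
        generalize (aM i * aP (i + 1)
          - ((-1 : K) ^ (thetaIdx n i * thetaIdx n (i + 1))) • (aP (i + 1) * aM i)) = Y at *
        have hYX : L i * (Y * X) = Y * X * L i := by
          unfold QC at hDD'
          rw [hDD', ← zpow_add₀ hq0]
          simp
        have E1 : X * L i * (Lb i * Y) = X * Y := by
          rw [mul_assoc, ← mul_assoc (L i), I1, one_mul]
        have E2 : Lb i * Y * (X * L i) = Y * X := by
          rw [mul_assoc, ← mul_assoc Y, ← hYX, ← mul_assoc, I2, one_mul]
        have hpp : (-1 : K) ^ (pIdx n (i + 1) * pIdx n (i + 1)) =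
            (-1 : K) ^ thetaIdx n i * (-1 : K) ^ thetaIdx n (i + 1) := by
          simp only [pIdx, Nat.add_sub_cancel]
          rcases thetaIdx_cases n i with t | t <;>
            rcases thetaIdx_cases n (i + 1) with t' | t' <;> norm_num [t, t']
        rw [hpp]
        simp only [neg_mul_neg, smul_mul_smul_comm, E1, E2]
        have hss : (-1 : K) ^ thetaIdx n i * (-1 : K) ^ thetaIdx n i = 1 := by
          rcases hs with h | h <;> rw [h] <;> simp
        rw [hss, one_smul, one_smul, key, Nat.add_sub_cancel]
        rcases thetaIdx_cases n i with t | t <;> simp only [t]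
        · simp [B9]
        · simp only [pow_one, neg_mul, one_mul, one_ne_zero, if_false, neg_smul, ← smul_neg,
            neg_sub, B9]
      · rw [if_neg (by omega), zero_smul, sub_eq_zero, he i hi1 hi', hf j hj1 hj']
        change QC _ _ _
        refine QC.neg_smul_left _ (QC.neg_smul_right _ ?_)
        have A1 := T3 i j hi1 hi' hj1 (by omega)
        rw [if_neg (show ¬ j = i from fun h => hij h.symm), mul_zero, zero_smul, add_zero] at A1
        have A2 := T2 i (j + 1) hi1 hi' hj hj'
        rw [if_neg (show ¬ j + 1 = i + 1 by omega), mul_zero, zero_smul, sub_zero] at A2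
        have A3 := QC.sub_smul_right ((-1 : K) ^ (thetaIdx n j * thetaIdx n (j + 1)))
          (QC.mul_right A1 A2) ((QC.mul_right A2 A1).cast (mul_comm _ _))
        have A4 := flip _ _ _ (toLb _ _ _ hj1 (by omega) (LE j i hj1 (by omega) hi1 hi'))
        have A5 := LF i j hi1 (by omega) hj1 hj'
        have A6 := LLb i j hi1 (by omega) hj1 (by omega)
        refine ((A4.mul_right A3).mul_left (A6.mul_right A5)).cast ?_
        have hji : ¬ j = i := fun h => hij h.symm
        have hsg : (-1 : K) ^ (pIdx n (i + 1) * pIdx n (j + 1)) =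
            (-1 : K) ^ ((thetaIdx n i + thetaIdx n (i + 1)) * thetaIdx n j) *
            (-1 : K) ^ ((thetaIdx n i + thetaIdx n (i + 1)) * thetaIdx n (j + 1)) := by
          rw [← pow_add, ← mul_add]; simp [pIdx]
        have hz : ∀ (a b : K) (x y z w : ℤ), x + (y + z) + w = 0 →
            q ^ x * ((a * q ^ y) * (b * q ^ z)) * (1 * q ^ w) = a * b := by
          intro a b x y z w h
          have : q ^ x * (q ^ y * q ^ z) * q ^ w = 1 := by
            rw [← zpow_add₀ hq0, ← zpow_add₀ hq0, ← zpow_add₀ hq0, h, zpow_zero]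
          linear_combination a * b * this
        rw [hsg]
        apply hz
        simp only [hij, hji, if_false, eq_comm (a := i + 1) (b := j)]
        by_cases u : j = i + 1
        · subst u
          have : ¬ i = i + 1 + 1 := by omega
          simp [this]
        · simp [u]
end

section
/- (Theorem, converse direction: the triple Serre relations (22b), (22e) follow from relations (38).) For every i ≠ n+1 and every j = i±1 with 1 ≤ j ≤ N: [e_i,[e_i,e_j]_{q̄}]_q = 0 and [e_i,[e_i,e_j]_q]_{q̄} = 0, and likewise [f_i,[f_i,f_j]_{q̄}]_q = 0 and [f_i,[f_i,f_j]_q]_{q̄} = 0. -/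
/-- Serre combination. -/
theorem serre_core {K A : Type*} [Field K] [Ring A] [Algebra K A]
    (t : K) (ht : t ≠ 0) (e X Y : A) (h1 : e * X = t • (X * e) + Y)
    (h2 : e * Y = t⁻¹ • (Y * e)) :
    e * (e * X) - (t + t⁻¹) • (e * (X * e)) + X * (e * e) = 0 := by
  have hY : Y = e * X - t • (X * e) := by rw [h1]; abel
  subst hY
  simp only [mul_sub, sub_mul, mul_smul_comm, smul_mul_assoc, smul_sub, smul_smul,
    inv_mul_cancel₀ ht, mul_assoc] at h2
  have h3 := sub_eq_zero.mpr h2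
  rw [← h3]
  module

theorem half_serre {K A : Type*} [Field K] [Ring A] [Algebra K A]
    (N : ℕ) (q : K) (hq0 : q ≠ 0) (aP aM L Lb u e : ℕ → A) (s : ℕ → ℤ) (σ : ℕ → K)
    (hs : ∀ l, s l = 1 ∨ s l = -1)
    (hLinv : ∀ i, 1 ≤ i → i ≤ N → L i * Lb i = 1 ∧ Lb i * L i = 1)
    (hLcomm : ∀ i j, 1 ≤ i → i ≤ N → 1 ≤ j → j ≤ N →
      L i * L j = L j * L i ∧ L i * Lb j = Lb j * L i)
    (LM : ∀ i j, 1 ≤ i → i ≤ N → 1 ≤ j → j ≤ N →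
      L i * aM j = (q ^ (1 + if i = j then s i else 0)) • (aM j * L i))
    (LP : ∀ i j, 1 ≤ i → i ≤ N → 1 ≤ j → j ≤ N →
      L i * aP j = (q ^ (-(1 + if i = j then s i else 0))) • (aP j * L i))
    (hu : ∀ l, 1 ≤ l → l + 1 ≤ N →
      u l = aM (l + 1) * aP l - σ l • (aP l * aM (l + 1)))
    (T1a : ∀ l k, 1 ≤ l → l + 1 ≤ N → 1 ≤ k → k ≤ N → k ≠ l → k ≠ l + 1 → s l = s (l + 1) →
      u l * aM k = q⁻¹ • (aM k * u l))
    (T1b : ∀ l, 1 ≤ l → l + 1 ≤ N → s l = s (l + 1) →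
      u l * aM (l + 1) = q ^ (-1 - s l) • (aM (l + 1) * u l))
    (T1c : ∀ l, 1 ≤ l → l + 1 ≤ N → (s l = s (l + 1) ∨ s l = 1) →
      u l * aM l = q⁻¹ • (aM l * u l) + (s l : K) • (Lb l * aM (l + 1)))
    (T2a : ∀ l k, 1 ≤ l → l + 1 ≤ N → 1 ≤ k → k ≤ N → k ≠ l → k ≠ l + 1 → s l = s (l + 1) →
      u l * aP k = q • (aP k * u l))
    (T2b : ∀ l, 1 ≤ l → l + 1 ≤ N → s l = s (l + 1) →
      u l * aP l = q ^ (1 + s l) • (aP l * u l))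
    (T2c : ∀ l, 1 ≤ l → l + 1 ≤ N → s l = s (l + 1) → ∃ c : K,
      u l * aP (l + 1) = q • (aP (l + 1) * u l) + c • (Lb (l + 1) * aP l))
    (h12 : 2 ≤ N → s 1 = 1 → aM 1 * aM 2 = q • (aM 2 * aM 1))
    (he1 : e 1 = aM 1)
    (he : ∀ l, 1 ≤ l → l + 1 ≤ N → e (l + 1) = -((s l : K) • (u l * L l))) :
    ∀ i j, 1 ≤ i → i ≤ N → 1 ≤ j → j ≤ N → (i = 1 → s 1 = 1) →
      (2 ≤ i → s (i - 1) = s i) → (j = i + 1 ∨ i = j + 1) →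
      e i * (e i * e j) - (q + q⁻¹) • (e i * (e j * e i)) + e j * (e i * e i) = 0 := by
  have hss : ∀ l, (s l : K) * (s l : K) = 1 := by
    intro l; rcases hs l with h | h <;> simp [h]
  have Em_l : ∀ l, 1 ≤ l → l + 1 ≤ N → (s l = s (l + 1) ∨ s l = 1) →
      e (l + 1) * aM l = q ^ s l • (aM l * e (l + 1)) - q ^ s l • aM (l + 1) := by
    intro l h1 h2 h3
    have hx : Lb l * aM (l + 1) * L l = q⁻¹ • aM (l + 1) := by
      have := LM l (l + 1) h1 (by omega) (by omega) h2
      rw [if_neg (by omega), add_zero, zpow_one] at this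
      have h5 : aM (l + 1) * L l = q⁻¹ • (L l * aM (l + 1)) := by
        rw [this, smul_smul, inv_mul_cancel₀ hq0, one_smul]
      rw [mul_assoc, h5, mul_smul_comm, ← mul_assoc, (hLinv l h1 (by omega)).2, one_mul]
    have hLl := LM l l h1 (by omega) h1 (by omega)
    rw [if_pos rfl] at hLl
    rw [he l h1 h2, neg_mul, smul_mul_assoc, mul_assoc, hLl, mul_smul_comm, ← mul_assoc,
      T1c l h1 h2 h3, add_mul, smul_mul_assoc, smul_mul_assoc, hx, mul_neg, mul_smul_comm,
      mul_assoc]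
    have hz : q ^ (1 + s l) = q * q ^ s l := by rw [zpow_add₀ hq0, zpow_one]
    rw [hz]
    have e1 : q * q⁻¹ = 1 := mul_inv_cancel₀ hq0
    have e2 := hss l
    match_scalars
    · linear_combination (-(s l : K) * q ^ s l) * e1
    · linear_combination (-(s l : K) * (s l : K) * q ^ s l) * e1 - q ^ s l * e2
  have Em_l1 : ∀ l, 1 ≤ l → l + 1 ≤ N → s l = s (l + 1) →
      e (l + 1) * aM (l + 1) = (q ^ s l)⁻¹ • (aM (l + 1) * e (l + 1)) := by
    intro l h1 h2 h3
    have hLl := LM l (l + 1) h1 (by omega) (by omega) h2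
    rw [if_neg (by omega), add_zero, zpow_one] at hLl
    rw [he l h1 h2, neg_mul, smul_mul_assoc, mul_assoc, hLl, mul_smul_comm, ← mul_assoc,
      T1b l h1 h2 h3, smul_mul_assoc, mul_neg, mul_smul_comm, mul_assoc]
    have hz : q ^ (-1 - s l) = q⁻¹ * (q ^ s l)⁻¹ := by
      rw [sub_eq_add_neg, zpow_add₀ hq0, zpow_neg, zpow_neg, zpow_one]
    rw [hz]
    have e1 : q * q⁻¹ = 1 := mul_inv_cancel₀ hq0
    match_scalars
    linear_combination (-(s l : K) * (q ^ s l)⁻¹) * e1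
  have Em_k : ∀ l k, 1 ≤ l → l + 1 ≤ N → 1 ≤ k → k ≤ N → k ≠ l → k ≠ l + 1 → s l = s (l + 1) →
      e (l + 1) * aM k = aM k * e (l + 1) := by
    intro l k h1 h2 k1 k2 k3 k4 h3
    have hLl := LM l k h1 (by omega) k1 k2
    rw [if_neg (by omega), add_zero, zpow_one] at hLl
    rw [he l h1 h2, neg_mul, smul_mul_assoc, mul_assoc, hLl, mul_smul_comm, ← mul_assoc,
      T1a l k h1 h2 k1 k2 k3 k4 h3, smul_mul_assoc, mul_neg, mul_smul_comm, mul_assoc]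
    have e1 : q * q⁻¹ = 1 := mul_inv_cancel₀ hq0
    match_scalars
    linear_combination (-(s l : K)) * e1
  have Ep_k : ∀ l k, 1 ≤ l → l + 1 ≤ N → 1 ≤ k → k ≤ N → k ≠ l → k ≠ l + 1 → s l = s (l + 1) →
      e (l + 1) * aP k = aP k * e (l + 1) := by
    intro l k h1 h2 k1 k2 k3 k4 h3
    have hLl := LP l k h1 (by omega) k1 k2
    rw [if_neg (by omega), add_zero, zpow_neg, zpow_one] at hLl
    rw [he l h1 h2, neg_mul, smul_mul_assoc, mul_assoc, hLl, mul_smul_comm, ← mul_assoc,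
      T2a l k h1 h2 k1 k2 k3 k4 h3, smul_mul_assoc, mul_neg, mul_smul_comm, mul_assoc]
    have e1 : q * q⁻¹ = 1 := mul_inv_cancel₀ hq0
    match_scalars
    linear_combination (-(s l : K)) * e1
  have Ep_l : ∀ l, 1 ≤ l → l + 1 ≤ N → s l = s (l + 1) →
      e (l + 1) * aP l = aP l * e (l + 1) := by
    intro l h1 h2 h3
    have hLl := LP l l h1 (by omega) h1 (by omega)
    rw [if_pos rfl, zpow_neg] at hLl
    rw [he l h1 h2, neg_mul, smul_mul_assoc, mul_assoc, hLl, mul_smul_comm, ← mul_assoc,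
      T2b l h1 h2 h3, smul_mul_assoc, mul_neg, mul_smul_comm, mul_assoc]
    have e1 : q ^ (1 + s l) * (q ^ (1 + s l))⁻¹ = 1 := mul_inv_cancel₀ (zpow_ne_zero _ hq0)
    match_scalars
    linear_combination (-(s l : K)) * e1
  have Ep_l1 : ∀ l, 1 ≤ l → l + 1 ≤ N → s l = s (l + 1) → ∃ c : K,
      e (l + 1) * aP (l + 1) = aP (l + 1) * e (l + 1) + c • (Lb (l + 1) * (aP l * L l)) := by
    intro l h1 h2 h3
    obtain ⟨c, hc⟩ := T2c l h1 h2 h3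
    have hLl := LP l (l + 1) h1 (by omega) (by omega) h2
    rw [if_neg (by omega), add_zero, zpow_neg, zpow_one] at hLl
    refine ⟨-(s l : K) * q⁻¹ * c, ?_⟩
    rw [he l h1 h2, neg_mul, smul_mul_assoc, mul_assoc, hLl, mul_smul_comm, ← mul_assoc,
      hc, add_mul, smul_mul_assoc, smul_mul_assoc, mul_neg, mul_smul_comm, mul_assoc, mul_assoc]
    have e1 : q * q⁻¹ = 1 := mul_inv_cancel₀ hq0
    match_scalars
    · linear_combination (-(s l : K)) * e1
    · ring
  -- L's against u's
  have Lu : ∀ i l, 1 ≤ i → i ≤ N → 1 ≤ l → l + 1 ≤ N →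
      L i * e (l + 1) = q ^ ((if i = l + 1 then s i else 0) - (if i = l then s i else 0)) •
        (e (l + 1) * L i) := by
    intro i l i1 i2 h1 h2
    have hM := LM i (l + 1) i1 i2 (by omega) h2
    have hP := LP i l i1 i2 h1 (by omega)
    have hLL := (hLcomm i l i1 i2 h1 (by omega)).1
    have g1 : L i * (aM (l + 1) * aP l) =
        q ^ ((if i = l + 1 then s i else 0) - (if i = l then s i else 0)) •
        ((aM (l + 1) * aP l) * L i) := by
      rw [← mul_assoc, hM, smul_mul_assoc, mul_assoc, hP, mul_smul_comm, smul_smul,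
        ← zpow_add₀ hq0, mul_assoc]
      congr 2; ring
    have g2 : L i * (aP l * aM (l + 1)) =
        q ^ ((if i = l + 1 then s i else 0) - (if i = l then s i else 0)) •
        ((aP l * aM (l + 1)) * L i) := by
      rw [← mul_assoc, hP, smul_mul_assoc, mul_assoc, hM, mul_smul_comm, smul_smul,
        ← zpow_add₀ hq0, mul_assoc]
      congr 2; ring
    have g3 : L i * u l =
        q ^ ((if i = l + 1 then s i else 0) - (if i = l then s i else 0)) • (u l * L i) := by
      rw [hu l h1 h2, mul_sub, mul_smul_comm, g1, g2, sub_mul, smul_mul_assoc]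
      module
    rw [he l h1 h2, mul_neg, mul_smul_comm, ← mul_assoc, g3, smul_mul_assoc, mul_assoc, hLL,
      neg_mul, smul_mul_assoc, mul_assoc]
    module
  have hqs : ∀ l, q + q⁻¹ = q ^ s l + (q ^ s l)⁻¹ := by
    intro l; rcases hs l with h | h <;> simp [h, add_comm]
  intro i j hi1 hi2 hj1 hj2 hi3 hi4 hij
  by_cases hi : i = 1
  · subst hi
    have hj : j = 2 := by omega
    subst hj
    have hs1 := hi3 rfl
    have hA := Em_l 1 le_rfl hj2 (Or.inr hs1)
    norm_num [hs1] at hA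
    rw [he1] at *
    rw [add_comm q]
    have := serre_core q⁻¹ (inv_ne_zero hq0) (aM 1) (e 2) (aM 2) (by
      rw [hA, smul_sub, smul_smul, smul_smul, inv_mul_cancel₀ hq0]; module) (by
      rw [inv_inv]; exact h12 hj2 hs1)
    rwa [inv_inv] at this
  · obtain ⟨l, rfl⟩ : ∃ l, i = l + 1 := ⟨i - 1, by omega⟩
    have hl1 : 1 ≤ l := by omega
    have hsl : s l = s (l + 1) := by simpa using hi4 (by omega)
    rcases hij with rfl | hij
    · -- case C
      have ht := zpow_ne_zero (s l) hq0
      obtain ⟨c, hc⟩ := Ep_l1 l hl1 hi2 hsl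
      have hX := he (l + 1) (by omega) hj2
      have hU := hu (l + 1) (by omega) hj2
      have hx := Em_k l (l + 2) hl1 hi2 (by omega) hj2 (by omega) (by omega) hsl
      have hpl := Ep_l l hl1 hi2 hsl
      have hM := Lu (l + 1) l (by omega) hi2 hl1 hi2
      have hM2 := Lu l l hl1 (by omega) hl1 hi2
      rw [if_pos rfl, if_neg (by omega), sub_zero, ← hsl] at hM
      rw [if_pos rfl, if_neg (by omega), zero_sub, zpow_neg] at hM2
      have hLi := hLinv (l + 1) (by omega) hi2
      have heM : e (l + 1) * L (l + 1) = (q ^ s l)⁻¹ • (L (l + 1) * e (l + 1)) := by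
        rw [hM, smul_smul, inv_mul_cancel₀ ht, one_smul]
      have heM2 : e (l + 1) * L l = (q ^ s l) • (L l * e (l + 1)) := by
        rw [hM2, smul_smul, mul_inv_cancel₀ ht, one_smul]
      have heLb : e (l + 1) * Lb (l + 1) = (q ^ s l) • (Lb (l + 1) * e (l + 1)) := by
        calc e (l + 1) * Lb (l + 1)
            = Lb (l + 1) * (L (l + 1) * e (l + 1)) * Lb (l + 1) := by
              rw [← mul_assoc, hLi.2, one_mul]
          _ = _ := by
              rw [hM, mul_smul_comm, smul_mul_assoc, mul_assoc, mul_assoc, hLi.1, mul_one]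
      obtain ⟨z, hz⟩ : ∃ z, z = c • (Lb (l + 1) * (aP l * L l)) := ⟨_, rfl⟩
      rw [← hz] at hc
      have hez : e (l + 1) * z = (q ^ s l * q ^ s l) • (z * e (l + 1)) := by
        rw [hz, mul_smul_comm, ← mul_assoc, heLb, smul_mul_assoc, mul_assoc,
          ← mul_assoc (e (l + 1)), hpl, mul_assoc (aP l), heM2]
        simp only [mul_smul_comm, smul_mul_assoc, mul_assoc]
        module
      have key := serre_core (q ^ s l)⁻¹ (inv_ne_zero ht) (e (l + 1)) (e (l + 1 + 1))
        (-((s (l + 1) : K) • ((aM (l + 2) * z - σ (l + 1) • (z * aM (l + 2))) * L (l + 1))))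
      rw [inv_inv, add_comm (q ^ s l)⁻¹, ← hqs] at key
      generalize hE : e (l + 1) = E at *
      generalize hMM : L (l + 1) = M at *
      generalize hxx : aM (l + 2) = x at *
      have hxx2 : aM (l + 1 + 1) = x := hxx
      rw [hxx2] at *
      generalize hpp : aP (l + 1) = p at *
      apply key
      · rw [hX, hU]
        have g1 : E * (x * p * M) = (q ^ s l)⁻¹ • (x * p * M * E) + x * z * M := by
          rw [mul_assoc x, ← mul_assoc E, hx, mul_assoc x, ← mul_assoc E, hc, add_mul, mul_assoc p,
            heM]
          simp only [mul_smul_comm, mul_add, mul_assoc]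
        have g2 : E * (p * x * M) = (q ^ s l)⁻¹ • (p * x * M * E) + z * x * M := by
          rw [mul_assoc p, ← mul_assoc E, hc, add_mul, mul_assoc p, ← mul_assoc E, hx, mul_assoc x,
            heM]
          simp only [mul_smul_comm, mul_assoc]
        simp only [mul_neg, neg_mul, sub_mul, mul_sub, mul_smul_comm, smul_mul_assoc, g1, g2]
        module
      · have g1 : E * (x * z * M) = (q ^ s l) • (x * z * M * E) := by
          rw [mul_assoc x, ← mul_assoc E, hx, mul_assoc x, ← mul_assoc E, hez, smul_mul_assoc,
            mul_assoc z, heM]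
          simp only [mul_smul_comm, smul_smul, mul_assoc, mul_inv_cancel₀ ht, mul_one]
        have g2 : E * (z * x * M) = (q ^ s l) • (z * x * M * E) := by
          rw [mul_assoc z, ← mul_assoc E, hez, smul_mul_assoc, mul_assoc z, ← mul_assoc E, hx,
            mul_assoc x, heM]
          simp only [mul_smul_comm, smul_smul, mul_assoc, mul_inv_cancel₀ ht, mul_one]
        simp only [mul_neg, neg_mul, sub_mul, mul_sub, mul_smul_comm, smul_mul_assoc, g1, g2]
        module
    · obtain rfl : j = l := by omega
      have ht := zpow_ne_zero (s j) hq0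
      have hx := Em_l j hl1 hi2 (Or.inl hsl)
      have hy := Em_l1 j hl1 hi2 hsl
      rw [hqs j]
      by_cases hj : j = 1
      · subst hj
        rw [he1]
        refine serre_core _ ht _ _ (-(q ^ s 1 • aM (1 + 1))) (by rw [hx]; abel) ?_
        rw [mul_neg, mul_smul_comm, hy, neg_mul, smul_mul_assoc]
        module
      · obtain ⟨k, rfl⟩ : ∃ k, j = k + 1 := ⟨j - 1, by omega⟩
        have hk1 : 1 ≤ k := by omega
        have hp := Ep_k (k + 1) k hl1 hi2 hk1 (by omega) (by omega) (by omega) hsl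
        have hX := he k hk1 hj2
        have hU := hu k hk1 hj2
        have hM := Lu k (k + 1) hk1 (by omega) hl1 hi2
        rw [if_neg (by omega), if_neg (by omega), sub_zero, zpow_zero, one_smul] at hM
        have key := serre_core (q ^ s (k + 1)) ht (e (k + 1 + 1)) (e (k + 1))
          ((s k : K) • q ^ s (k + 1) • ((aM (k + 2) * aP k - σ k • (aP k * aM (k + 2))) * L k))
        generalize hE : e (k + 1 + 1) = E at *
        generalize hMM : L k = M at *
        have hyy2 : aM (k + 1 + 1) = aM (k + 2) := rfl
        rw [hyy2] at *
        generalize hxx : aM (k + 1) = x at *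
        generalize hyy : aM (k + 2) = y at *
        generalize hpp : aP k = p at *
        generalize q ^ s (k + 1) = t at *
        apply key
        · rw [hX, hU]
          have g1 : E * (x * p * M) = t • (x * p * M * E) - t • (y * p * M) := by
            rw [mul_assoc x, ← mul_assoc E, hx, sub_mul, smul_mul_assoc, smul_mul_assoc,
              mul_assoc x, ← mul_assoc E, hp, mul_assoc p, ← hM]
            simp only [mul_assoc]
          have g2 : E * (p * x * M) = t • (p * x * M * E) - t • (p * y * M) := by
            rw [mul_assoc p, ← mul_assoc E, hp, mul_assoc p, ← mul_assoc E, hx, sub_mul,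
              smul_mul_assoc, smul_mul_assoc, mul_assoc x, ← hM]
            simp only [mul_assoc, mul_sub, mul_smul_comm]
          simp only [mul_neg, neg_mul, sub_mul, mul_sub, mul_smul_comm, smul_mul_assoc, g1, g2]
          module
        · have g1 : E * (y * p * M) = t⁻¹ • (y * p * M * E) := by
            rw [mul_assoc y, ← mul_assoc E, hy, smul_mul_assoc,
              mul_assoc y, ← mul_assoc E, hp, mul_assoc p, ← hM]
            simp only [mul_assoc]
          have g2 : E * (p * y * M) = t⁻¹ • (p * y * M * E) := by
            rw [mul_assoc p, ← mul_assoc E, hp, mul_assoc p, ← mul_assoc E, hy,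
              smul_mul_assoc, mul_assoc y, ← hM]
            simp only [mul_assoc, mul_smul_comm]
          simp only [sub_mul, mul_sub, mul_smul_comm, smul_mul_assoc, g1, g2]
          module

/-- Theorem, converse direction: the triple Serre relations (22b), (22e) follow
from the relations (38). -/
theorem stmt18
    (K : Type*) (A : Type*) [Field K] [Ring A] [Algebra K A]
    (n m : ℕ) (hm : 1 ≤ m)
    (q : K) (hq0 : q ≠ 0) (hq1 : q ^ 2 ≠ 1)
    (aP aM L Lb : ℕ → A)
    -- L_i L̄_i = L̄_i L_i = 1
    (hLinv : ∀ i, 1 ≤ i → i ≤ n + m → L i * Lb i = 1 ∧ Lb i * L i = 1)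
    -- all L_i, L̄_j commute with one another
    (hLcomm : ∀ i j, 1 ≤ i → i ≤ n + m → 1 ≤ j → j ≤ n + m →
      L i * L j = L j * L i ∧ L i * Lb j = Lb j * L i ∧ Lb i * Lb j = Lb j * Lb i)
    -- L_i a_j^- = q^{1+(−1)^{θ_i}δ_{ij}} a_j^- L_i
    (hLaM : ∀ i j, 1 ≤ i → i ≤ n + m → 1 ≤ j → j ≤ n + m →
      L i * aM j
        = (q ^ ((1 : ℤ) + (-1 : ℤ) ^ thetaIdx n i * (if i = j then 1 else 0))) •
            (aM j * L i))
    -- L_i a_j^+ = q^{−(1+(−1)^{θ_i}δ_{ij})} a_j^+ L_i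
    (hLaP : ∀ i j, 1 ≤ i → i ≤ n + m → 1 ≤ j → j ≤ n + m →
      L i * aP j
        = (q ^ (-((1 : ℤ) + (-1 : ℤ) ^ thetaIdx n i * (if i = j then 1 else 0)))) •
            (aP j * L i))
    -- (38c)
    (h38c : ∀ i, 1 ≤ i → i ≤ n + m →
      aM i * aP i - ((-1 : K) ^ thetaIdx n i) • (aP i * aM i)
        = (q - q⁻¹)⁻¹ • (L i - Lb i))
    -- the encoding aa 1 = a^+, aa (-1) = a^-
    (aa : ℤ → ℕ → A) (haaP : ∀ j, aa 1 j = aP j) (haaM : ∀ j, aa (-1) j = aM j)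
    -- (38d): the triple relations
    (h38d : ∀ ξ η : ℤ, (ξ = 1 ∨ ξ = -1) → (η = 1 ∨ η = -1) →
      ∀ i k : ℕ, 1 ≤ i → 1 ≤ (i : ℤ) + ξ → (i : ℤ) + ξ ≤ (n + m : ℤ) →
        1 ≤ k → k ≤ n + m →
        (aa η i * aa (-η) ((i : ℤ) + ξ).toNat
            - ((-1 : K) ^ (thetaIdx n i * thetaIdx n ((i : ℤ) + ξ).toNat)) •
                (aa (-η) ((i : ℤ) + ξ).toNat * aa η i)) * aa η k
          - (((-1 : K) ^ ((thetaIdx n i + thetaIdx n ((i : ℤ) + ξ).toNat) * thetaIdx n k))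
              * q ^ (ξ * (1 + (-1 : ℤ) ^ thetaIdx n i * (if i = k then 1 else 0)))) •
              (aa η k *
                (aa η i * aa (-η) ((i : ℤ) + ξ).toNat
                  - ((-1 : K) ^ (thetaIdx n i * thetaIdx n ((i : ℤ) + ξ).toNat)) •
                      (aa (-η) ((i : ℤ) + ξ).toNat * aa η i)))
        = ((if thetaIdx n k = 0 then (1 : K) else (η : K))
              * (if (k : ℤ) = (i : ℤ) + ξ then 1 else 0)) •
            ((if ξ * η = 1 then Lb k else L k) * aa η i))
    -- (38e)
    (h38e : 2 ≤ n + m →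
      aP 1 * aP 2 - (((-1 : K) ^ (thetaIdx n 1 * thetaIdx n 2)) * q) • (aP 2 * aP 1) = 0 ∧
      aM 1 * aM 2 - (((-1 : K) ^ (thetaIdx n 1 * thetaIdx n 2)) * q) • (aM 2 * aM 1) = 0)
    (h38e1 : n = 0 → aP 1 * aP 1 = 0 ∧ aM 1 * aM 1 = 0)
    -- the Chevalley generators, defined from the CAGs
    (e f : ℕ → A)
    (he1 : e 1 = aM 1) (hf1 : f 1 = aP 1)
    (he : ∀ i, 1 ≤ i → i + 1 ≤ n + m →
      e (i + 1) = -(((-1 : K) ^ thetaIdx n i) •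
          ((aM (i + 1) * aP i
              - ((-1 : K) ^ (thetaIdx n i * thetaIdx n (i + 1))) • (aP i * aM (i + 1)))
            * L i)))
    (hf : ∀ i, 1 ≤ i → i + 1 ≤ n + m →
      f (i + 1) = -(((-1 : K) ^ thetaIdx n i) •
          (Lb i * (aM i * aP (i + 1)
              - ((-1 : K) ^ (thetaIdx n i * thetaIdx n (i + 1))) • (aP (i + 1) * aM i)))))
    :
    ∀ i j : ℕ, 1 ≤ i → i ≤ n + m → 1 ≤ j → j ≤ n + m → i ≠ n + 1 →
      (j = i + 1 ∨ i = j + 1) →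
      cmx q (e i) (cmx q⁻¹ (e i) (e j)) = 0 ∧
      cmx q⁻¹ (e i) (cmx q (e i) (e j)) = 0 ∧
      cmx q (f i) (cmx q⁻¹ (f i) (f j)) = 0 ∧
      cmx q⁻¹ (f i) (cmx q (f i) (f j)) = 0 := by
  have hth : ∀ l, thetaIdx n l = 0 ∨ thetaIdx n l = 1 := by
    intro l; unfold thetaIdx; split_ifs <;> simp
  obtain ⟨s, hsdef⟩ : ∃ s : ℕ → ℤ, ∀ l, s l = (-1 : ℤ) ^ thetaIdx n l := ⟨_, fun _ => rfl⟩
  have hs : ∀ l, s l = 1 ∨ s l = -1 := by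
    intro l; rw [hsdef]; rcases hth l with h | h <;> simp [h]
  have hsK : ∀ l, (-1 : K) ^ thetaIdx n l = (s l : K) := by
    intro l; rw [hsdef]; push_cast; rfl
  obtain ⟨σ, hσ⟩ : ∃ σ : ℕ → K, ∀ l, σ l = (-1 : K) ^ (thetaIdx n l * thetaIdx n (l + 1)) :=
    ⟨_, fun _ => rfl⟩
  have hσσ : ∀ l, σ l * σ l = 1 := by
    intro l; rw [hσ]
    rcases hth l with h | h <;> rcases hth (l + 1) with h' | h' <;> simp [h, h']
  have hseq : ∀ l, s l = s (l + 1) → thetaIdx n l = thetaIdx n (l + 1) := by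
    intro l; rw [hsdef, hsdef]
    rcases hth l with h | h <;> rcases hth (l + 1) with h' | h' <;> simp [h, h']
  have hs1 : ∀ l, s l = 1 → thetaIdx n l = 0 := by
    intro l; rw [hsdef]
    rcases hth l with h | h <;> simp [h]
  -- sign in the triple relation
  have hsgn : ∀ l k, (s l = s (l + 1) ∨ (s k = 1)) →
      (-1 : K) ^ ((thetaIdx n l + thetaIdx n (l + 1)) * thetaIdx n k) = 1 := by
    intro l k h
    rcases h with h | h
    · rw [hseq l h, ← two_mul, mul_assoc, pow_mul]; simp
    · rw [hs1 k h]; simp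
  have hsk : ∀ k, (if thetaIdx n k = 0 then (1 : K) else ((-1 : ℤ) : K)) = (s k : K) := by
    intro k; rw [hsdef]
    rcases hth k with h | h <;> simp [h]
  have hσs : ∀ l, (s l = s (l + 1) ∨ s l = 1) → σ l = s l := by
    intro l h
    rw [hσ, hsdef]
    rcases h with h | h
    · rw [← hseq l h]; rcases hth l with h | h <;> simp [h]
    · simp [hs1 l h]
  obtain ⟨u, hu⟩ : ∃ u : ℕ → A, ∀ l, u l = aM (l + 1) * aP l - σ l • (aP l * aM (l + 1)) :=
    ⟨_, fun _ => rfl⟩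
  obtain ⟨v, hv⟩ : ∃ v : ℕ → A, ∀ l, v l = aM l * aP (l + 1) - σ l • (aP (l + 1) * aM l) :=
    ⟨_, fun _ => rfl⟩
  have hT1 : ∀ l k, 1 ≤ l → l + 1 ≤ n + m → 1 ≤ k → k ≤ n + m →
      (s l = s (l + 1) ∨ (s k = 1)) →
      u l * aM k - q ^ (-(1 + if l + 1 = k then s (l + 1) else 0)) • (aM k * u l)
        = ((s k : K) * if k = l then 1 else 0) • (Lb k * aM (l + 1)) := by
    intro l k h1 h2 k1 k2 h3
    have h := h38d (-1) (-1) (Or.inr rfl) (Or.inr rfl) (l + 1) k (by omega) (by push_cast; omega)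
      (by push_cast; omega) k1 k2
    have t1 : (((l + 1 : ℕ) : ℤ) + -1).toNat = l := by omega
    have t2 : ((k : ℤ) = ((l + 1 : ℕ) : ℤ) + -1) ↔ k = l := by omega
    rw [t1, hsk] at h
    simp only [neg_neg, haaP, haaM, t2, mul_comm (thetaIdx n (l + 1)) (thetaIdx n l),
      add_comm (thetaIdx n (l + 1)) (thetaIdx n l), ← hσ, ← hu, hsgn l k h3, ← hsdef] at h
    simpa using h
  have hT2 : ∀ l k, 1 ≤ l → l + 1 ≤ n + m → 1 ≤ k → k ≤ n + m →
      (s l = s (l + 1) ∨ (s k = 1)) →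
      u l * aP k - q ^ (1 + if l = k then s l else 0) • (aP k * u l)
        = (-(σ l) * if k = l + 1 then 1 else 0) • (Lb k * aP l) := by
    intro l k h1 h2 k1 k2 h3
    have h := h38d 1 1 (Or.inl rfl) (Or.inl rfl) l k h1 (by omega)
      (by push_cast; omega) k1 k2
    have t1 : ((l : ℤ) + 1).toNat = l + 1 := by omega
    have t2 : ((k : ℤ) = (l : ℤ) + 1) ↔ k = l + 1 := by omega
    have hD : aP l * aM (l + 1) - σ l • (aM (l + 1) * aP l) = -(σ l • u l) := by
      rw [hu, smul_sub, smul_smul, hσσ]; module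
    rw [t1] at h
    simp only [haaP, haaM, t2, ← hσ, hD, hsgn l k h3, ← hsdef] at h
    simp only [mul_ite, mul_one, mul_zero, one_mul, ite_self, neg_mul, mul_neg, smul_mul_assoc,
      mul_smul_comm, Int.cast_one, if_true] at h
    have h' := congrArg (fun w => -(σ l) • w) h
    simp only [smul_smul] at h'
    have e1 := hσσ l
    calc _ = -σ l • (-(σ l • (u l * aP k)) - q ^ (1 + if l = k then s l else 0) •
                -(σ l • (aP k * u l))) := by
            match_scalars
            · linear_combination -e1
            · linear_combination (q ^ (1 + if l = k then s l else 0)) * e1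
      _ = _ := by rw [h']
  have hT3 : ∀ l k, 1 ≤ l → l + 1 ≤ n + m → 1 ≤ k → k ≤ n + m →
      (s l = s (l + 1) ∨ (s k = 1)) →
      v l * aP k - q ^ (-(1 + if l + 1 = k then s (l + 1) else 0)) • (aP k * v l)
        = (-(σ l) * if k = l then 1 else 0) • (L k * aP (l + 1)) := by
    intro l k h1 h2 k1 k2 h3
    have h := h38d (-1) 1 (Or.inr rfl) (Or.inl rfl) (l + 1) k (by omega) (by push_cast; omega)
      (by push_cast; omega) k1 k2
    have t1 : (((l + 1 : ℕ) : ℤ) + -1).toNat = l := by omega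
    have t2 : ((k : ℤ) = ((l + 1 : ℕ) : ℤ) + -1) ↔ k = l := by omega
    have hD : aP (l + 1) * aM l - σ l • (aM l * aP (l + 1)) = -(σ l • v l) := by
      rw [hv, smul_sub, smul_smul, hσσ]; module
    rw [t1] at h
    simp only [haaP, haaM, t2, mul_comm (thetaIdx n (l + 1)) (thetaIdx n l),
      add_comm (thetaIdx n (l + 1)) (thetaIdx n l), ← hσ, hD, hsgn l k h3, ← hsdef] at h
    have hne : ¬ ((-1 : ℤ) * 1 = 1) := by norm_num
    simp only [if_neg hne] at h
    simp only [mul_ite, mul_one, mul_zero, one_mul, ite_self, neg_mul, mul_neg, smul_mul_assoc,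
      mul_smul_comm, Int.cast_one] at h
    have h' := congrArg (fun w => -(σ l) • w) h
    simp only [smul_smul] at h'
    have e1 := hσσ l
    calc _ = -σ l • (-(σ l • (v l * aP k)) - q ^ (-(1 + if l + 1 = k then s (l + 1) else 0)) •
                -(σ l • (aP k * v l))) := by
            match_scalars
            · linear_combination -e1
            · linear_combination (q ^ (-(1 + if l + 1 = k then s (l + 1) else 0))) * e1
      _ = _ := by rw [h']
  have hT4 : ∀ l k, 1 ≤ l → l + 1 ≤ n + m → 1 ≤ k → k ≤ n + m →
      (s l = s (l + 1) ∨ (s k = 1)) →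
      v l * aM k - q ^ (1 + if l = k then s l else 0) • (aM k * v l)
        = ((s k : K) * if k = l + 1 then 1 else 0) • (L k * aM l) := by
    intro l k h1 h2 k1 k2 h3
    have h := h38d 1 (-1) (Or.inl rfl) (Or.inr rfl) l k h1 (by omega)
      (by push_cast; omega) k1 k2
    have t1 : ((l : ℤ) + 1).toNat = l + 1 := by omega
    have t2 : ((k : ℤ) = (l : ℤ) + 1) ↔ k = l + 1 := by omega
    rw [t1, hsk] at h
    simp only [neg_neg, haaP, haaM, t2, ← hσ, ← hv, hsgn l k h3, ← hsdef] at h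
    simpa using h
  have LM : ∀ i j, 1 ≤ i → i ≤ n + m → 1 ≤ j → j ≤ n + m →
      L i * aM j = (q ^ (1 + if i = j then s i else 0)) • (aM j * L i) := by
    intro i j a b c d
    have := hLaM i j a b c d
    rw [← hsdef] at this
    simpa using this
  have LP : ∀ i j, 1 ≤ i → i ≤ n + m → 1 ≤ j → j ≤ n + m →
      L i * aP j = (q ^ (-(1 + if i = j then s i else 0))) • (aP j * L i) := by
    intro i j a b c d
    have := hLaP i j a b c d
    rw [← hsdef] at this
    simpa using this
  -- commuting `Lb` through
  have conj : ∀ (i : ℕ) (x : A) (z : ℤ), 1 ≤ i → i ≤ n + m → L i * x = q ^ z • (x * L i) →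
      x * Lb i = q ^ z • (Lb i * x) := by
    intro i x z a b h
    have hLi := hLinv i a b
    calc x * Lb i = Lb i * (L i * x) * Lb i := by rw [← mul_assoc, hLi.2, one_mul]
      _ = _ := by rw [h, mul_smul_comm, smul_mul_assoc, mul_assoc, mul_assoc, hLi.1, mul_one]
  have h12 : 2 ≤ n + m → s 1 = 1 →
      aP 1 * aP 2 = q • (aP 2 * aP 1) ∧ aM 1 * aM 2 = q • (aM 2 * aM 1) := by
    intro h2 h
    have := h38e h2
    rw [hs1 1 h] at this
    simpa [sub_eq_zero] using this
  have E1 := half_serre (n + m) q hq0 aP aM L Lb u e s σ hs hLinv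
    (fun i j a b c d => ⟨(hLcomm i j a b c d).1, (hLcomm i j a b c d).2.1⟩) LM LP
    (fun l _ _ => hu l)
    (fun l k a b c d x y h => by
      have := hT1 l k a b c d (Or.inl h)
      rw [if_neg (Ne.symm y), if_neg x] at this
      simpa [sub_eq_zero] using this)
    (fun l a b h => by
      have := hT1 l (l + 1) a b (by omega) b (Or.inl h)
      rw [if_pos rfl, if_neg (by omega), mul_zero, zero_smul, sub_eq_zero] at this
      rw [this, h]; congr 2; ring)
    (fun l a b h => by
      have := hT1 l l a b a (by omega) h
      rw [if_neg (by omega), if_pos rfl, mul_one, sub_eq_iff_eq_add'] at this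
      simpa using this)
    (fun l k a b c d x y h => by
      have := hT2 l k a b c d (Or.inl h)
      rw [if_neg (Ne.symm x), if_neg y] at this
      simpa [sub_eq_zero] using this)
    (fun l a b h => by
      have := hT2 l l a b a (by omega) (Or.inl h)
      rw [if_pos rfl, if_neg (by omega), mul_zero, zero_smul, sub_eq_zero] at this
      exact this)
    (fun l a b h => by
      have := hT2 l (l + 1) a b (by omega) b (Or.inl h)
      rw [if_neg (by omega), sub_eq_iff_eq_add', add_zero, zpow_one] at this
      exact ⟨_, this⟩)
    (fun h2 h => (h12 h2 h).2) he1
    (fun l a b => by rw [he l a b, hsK, ← hσ, ← hu])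
  have opinj : ∀ x y : A, x = y → MulOpposite.op x = MulOpposite.op y := fun _ _ h => by rw [h]
  have E2 := half_serre (n + m) q⁻¹ (inv_ne_zero hq0) (fun i => MulOpposite.op (aM i))
    (fun i => MulOpposite.op (aP i)) (fun i => MulOpposite.op (Lb i))
    (fun i => MulOpposite.op (L i)) (fun i => MulOpposite.op (v i))
    (fun i => MulOpposite.op (f i)) s σ hs
    (fun i a b => by
      simp only [← MulOpposite.op_mul, ← MulOpposite.op_one]
      exact ⟨opinj _ _ (hLinv i a b).1, opinj _ _ (hLinv i a b).2⟩)
    (fun i j a b c d => by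
      simp only [← MulOpposite.op_mul]
      exact ⟨opinj _ _ (hLcomm i j a b c d).2.2.symm, opinj _ _ (hLcomm j i c d a b).2.1⟩)
    (fun i j a b c d => by
      simp only [← MulOpposite.op_mul, ← MulOpposite.op_smul]
      apply opinj
      rw [conj i _ _ a b (LP i j a b c d), inv_zpow'])
    (fun i j a b c d => by
      simp only [← MulOpposite.op_mul, ← MulOpposite.op_smul]
      apply opinj
      rw [conj i _ _ a b (LM i j a b c d), inv_zpow', neg_neg])
    (fun l _ _ => by
      simp only [← MulOpposite.op_mul, ← MulOpposite.op_smul, ← MulOpposite.op_sub]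
      exact opinj _ _ (hv l))
    (fun l k a b c d x y h => by
      simp only [← MulOpposite.op_mul, ← MulOpposite.op_smul]
      apply opinj
      have := hT3 l k a b c d (Or.inl h)
      rw [if_neg (Ne.symm y), if_neg x, mul_zero, zero_smul, sub_eq_zero, add_zero, zpow_neg,
        zpow_one] at this
      rw [this, smul_smul, inv_inv, mul_inv_cancel₀ hq0, one_smul])
    (fun l a b h => by
      simp only [← MulOpposite.op_mul, ← MulOpposite.op_smul]
      apply opinj
      have := hT3 l (l + 1) a b (by omega) b (Or.inl h)
      rw [if_pos rfl, if_neg (by omega), mul_zero, zero_smul, sub_eq_zero] at this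
      rw [this, smul_smul, inv_zpow', ← zpow_add₀ hq0, h]
      ring_nf; simp)
    (fun l a b h => by
      simp only [← MulOpposite.op_mul, ← MulOpposite.op_smul, ← MulOpposite.op_add]
      apply opinj
      have := hT3 l l a b a (by omega) h
      have hL := LP l (l + 1) a (by omega) (by omega) b
      rw [if_neg (by omega), add_zero, zpow_neg, zpow_one] at hL
      rw [if_neg (by omega), if_pos rfl, mul_one, sub_eq_iff_eq_add', add_zero, zpow_neg,
        zpow_one, hL, hσs l h] at this
      rw [this]
      have e1 : q * q⁻¹ = 1 := mul_inv_cancel₀ hq0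
      rw [inv_inv]
      match_scalars
      · linear_combination -e1
      · linear_combination (s l : K) * e1)
    (fun l k a b c d x y h => by
      simp only [← MulOpposite.op_mul, ← MulOpposite.op_smul]
      apply opinj
      have := hT4 l k a b c d (Or.inl h)
      rw [if_neg (Ne.symm x), if_neg y, mul_zero, zero_smul, sub_eq_zero, add_zero,
        zpow_one] at this
      rw [this, smul_smul, inv_mul_cancel₀ hq0, one_smul])
    (fun l a b h => by
      simp only [← MulOpposite.op_mul, ← MulOpposite.op_smul]
      apply opinj
      have := hT4 l l a b a (by omega) (Or.inl h)
      rw [if_pos rfl, if_neg (by omega), mul_zero, zero_smul, sub_eq_zero] at this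
      rw [this, smul_smul, inv_zpow', ← zpow_add₀ hq0]
      simp)
    (fun l a b h => by
      simp only [← MulOpposite.op_mul, ← MulOpposite.op_smul, ← MulOpposite.op_add]
      have := hT4 l (l + 1) a b (by omega) b (Or.inl h)
      have hL := LM (l + 1) l (by omega) b a (by omega)
      rw [if_neg (by omega), add_zero, zpow_one] at hL
      rw [if_neg (by omega), if_pos rfl, mul_one, sub_eq_iff_eq_add', add_zero,
        zpow_one, hL] at this
      refine ⟨-(s (l + 1) : K), opinj _ _ ?_⟩
      rw [this]
      have e1 : q * q⁻¹ = 1 := mul_inv_cancel₀ hq0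
      match_scalars
      · linear_combination -e1
      · linear_combination (-(s (l + 1) : K)) * e1)
    (fun h2 h => by
      simp only [← MulOpposite.op_mul, ← MulOpposite.op_smul]
      apply opinj
      rw [(h12 h2 h).1, smul_smul, inv_mul_cancel₀ hq0, one_smul])
    (by rw [hf1])
    (fun l a b => by
      simp only [← MulOpposite.op_mul, ← MulOpposite.op_smul, ← MulOpposite.op_neg]
      apply opinj
      rw [hf l a b, hsK, ← hσ, ← hv])
  intro i j i1 i2 j1 j2 hin hij
  have c1 : i = 1 → s 1 = 1 := by
    rintro rfl
    rw [hsdef]; unfold thetaIdx; rw [if_pos (by omega)]; simp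
  have c2 : 2 ≤ i → s (i - 1) = s i := by
    intro h
    rw [hsdef, hsdef]; unfold thetaIdx
    by_cases hh : i ≤ n
    · rw [if_pos hh, if_pos (by omega)]
    · rw [if_neg hh, if_neg (by omega)]
  have F1 := E1 i j i1 i2 j1 j2 c1 c2 hij
  have F2 := congrArg MulOpposite.unop (E2 i j i1 i2 j1 j2 c1 c2 hij)
  simp only [MulOpposite.unop_add, MulOpposite.unop_sub, MulOpposite.unop_smul,
    MulOpposite.unop_mul, MulOpposite.unop_op, MulOpposite.unop_zero, inv_inv, mul_assoc] at F2
  have e1 : q * q⁻¹ = 1 := mul_inv_cancel₀ hq0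
  have fin : ∀ (t : K) (x y : A), t ≠ 0 →
      x * (x * y) - (t + t⁻¹) • (x * (y * x)) + y * (x * x) = 0 →
      cmx t x (cmx t⁻¹ x y) = 0 := by
    intro t x y ht h
    have e1 : t * t⁻¹ = 1 := mul_inv_cancel₀ ht
    rw [← h]
    simp only [cmx, mul_sub, sub_mul, mul_smul_comm, smul_mul_assoc, mul_assoc, smul_sub,
      smul_smul, e1]
    module
  have hqi := inv_ne_zero hq0
  have F1' : e i * (e i * e j) - (q⁻¹ + q⁻¹⁻¹) • (e i * (e j * e i)) + e j * (e i * e i) = 0 := by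
    rw [inv_inv, add_comm q⁻¹]; exact F1
  have F3 : f i * (f i * f j) - (q + q⁻¹) • (f i * (f j * f i)) + f j * (f i * f i) = 0 := by
    rw [← F2]; module
  have F3' : f i * (f i * f j) - (q⁻¹ + q⁻¹⁻¹) • (f i * (f j * f i)) + f j * (f i * f i) = 0 := by
    rw [inv_inv, add_comm q⁻¹]; exact F3
  have G1 := fin q⁻¹ _ _ hqi F1'
  have G2 := fin q⁻¹ _ _ hqi F3'
  rw [inv_inv] at G1 G2
  exact ⟨fin q _ _ hq0 F1, G1, fin q _ _ hq0 F3, G2⟩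
end
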